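/- arXiv:2412.06701 — 4 statements merged into one kernel-verified Lean document; each statement's English description precedes it below -/
import Mathlib

section
/- Let r ≥ 1 and let x, y be positive definite real symmetric r×r matrices. Set u = y·x·y + y and v = y + x⁻¹. Then u and v are positive definite, and the change of variables (x, y) ↦ (u, v) is inverted by y = (u⁻¹ + v⁻¹)⁻¹ and x = v⁻¹·u·v⁻¹ + v⁻¹; moreover u = (y⁻¹ − (y + x⁻¹)⁻¹)⁻¹. -/
open Matrix

section ChangeOfVariables

variable {n R : Type*} [Fintype n] [DecidableEq n] [CommRing R] {x y : Matrix n n R}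

/-- The identity `P(y) x + y = y * x * (y + x⁻¹)`. -/
theorem Matrix.mul_mul_add_self_eq_mul_add_inv (hx : IsUnit x.det) :
    y * x * y + y = y * x * (y + x⁻¹) := by
  rw [mul_add, mul_nonsing_inv_cancel_right _ _ hx]

/-- The identity `P(y) x + y = (y + x⁻¹) * x * y`. -/
theorem Matrix.mul_mul_add_self_eq_add_inv_mul (hx : IsUnit x.det) :
    y * x * y + y = (y + x⁻¹) * x * y := by
  rw [add_mul, add_mul, nonsing_inv_mul _ hx, one_mul]

/-- The inverses of `P(y) x + y` and `y + x⁻¹` add up to `y⁻¹`. -/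
theorem Matrix.inv_mul_mul_add_self_add_inv (hx : IsUnit x.det) (hy : IsUnit y.det)
    (hv : IsUnit (y + x⁻¹).det) :
    (y * x * y + y)⁻¹ + (y + x⁻¹)⁻¹ = y⁻¹ := by
  calc
    _ = (y + x⁻¹)⁻¹ * (x⁻¹ * y⁻¹) + (y + x⁻¹)⁻¹ * (y * y⁻¹) := by
      rw [mul_mul_add_self_eq_mul_add_inv hx, mul_inv_rev, mul_inv_rev,
        mul_nonsing_inv _ hy, mul_one]
    _ = (y + x⁻¹)⁻¹ * (y + x⁻¹) * y⁻¹ := by noncomm_ring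
    _ = y⁻¹ := by rw [nonsing_inv_mul _ hv, one_mul]

/-- Recovering `x` from `P(y) x + y` and `y + x⁻¹`. -/
theorem Matrix.inv_mul_mul_inv_add_inv (hx : IsUnit x.det) (hv : IsUnit (y + x⁻¹).det) :
    (y + x⁻¹)⁻¹ * (y * x * y + y) * (y + x⁻¹)⁻¹ + (y + x⁻¹)⁻¹ = x := by
  calc
    _ = x * y * (y + x⁻¹)⁻¹ + x * x⁻¹ * (y + x⁻¹)⁻¹ := by
      rw [mul_mul_add_self_eq_add_inv_mul hx, mul_assoc (y + x⁻¹) x y,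
        nonsing_inv_mul_cancel_left _ _ hv, mul_nonsing_inv _ hx, one_mul]
    _ = x * (y + x⁻¹) * (y + x⁻¹)⁻¹ := by rw [mul_add, add_mul]
    _ = x := mul_nonsing_inv_cancel_right _ _ hv

end ChangeOfVariables

/-- For positive definite real symmetric matrices `x` and `y`, setting
`u = y * x * y + y` and `v = y + x⁻¹`, the matrices `u` and `v` are positive
definite, the change of variables `(x, y) ↦ (u, v)` is inverted by
`y = (u⁻¹ + v⁻¹)⁻¹` and `x = v⁻¹ * u * v⁻¹ + v⁻¹`, and moreover
`u = (y⁻¹ - (y + x⁻¹)⁻¹)⁻¹`. -/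
theorem stmt_1 (r : ℕ) (hr : 1 ≤ r) (x y : Matrix (Fin r) (Fin r) ℝ)
    (hx : x.PosDef) (hy : y.PosDef)
    (u v : Matrix (Fin r) (Fin r) ℝ)
    (hu : u = y * x * y + y) (hv : v = y + x⁻¹) :
    u.PosDef ∧ v.PosDef ∧
      y = (u⁻¹ + v⁻¹)⁻¹ ∧ x = v⁻¹ * u * v⁻¹ + v⁻¹ ∧
      u = (y⁻¹ - (y + x⁻¹)⁻¹)⁻¹ := by
  have hv_pos : (y + x⁻¹).PosDef := hy.add hx.inv
  have hu_pos : (y * x * y + y).PosDef := by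
    have hyxy : (y * x * y).PosSemidef := by
      simpa only [hy.isHermitian.eq] using hx.posSemidef.mul_mul_conjTranspose_same y
    exact PosDef.posSemidef_add hyxy hy
  have hx_det := (isUnit_iff_isUnit_det x).1 hx.isUnit
  have hy_det := (isUnit_iff_isUnit_det y).1 hy.isUnit
  have hv_det := (isUnit_iff_isUnit_det _).1 hv_pos.isUnit
  have hu_det := (isUnit_iff_isUnit_det _).1 hu_pos.isUnit
  have hsum := inv_mul_mul_add_self_add_inv hx_det hy_det hv_det
  subst hu hv
  refine ⟨hu_pos, hv_pos, ?_, (inv_mul_mul_inv_add_inv hx_det hv_det).symm, ?_⟩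
  · rw [hsum, nonsing_inv_nonsing_inv _ hy_det]
  · rw [← hsum, add_sub_cancel_right, nonsing_inv_nonsing_inv _ hu_det]
end

section
/- Fix an integer r ≥ 1 and let V be the finite-dimensional real normed vector space of symmetric r×r real matrices. Define F : V × V → V × V by F(x, y) = (y·x·y + y, y + x⁻¹) (using matrix products and matrix inverse, with a junk value when x is not invertible). For every pair (x, y) with x and y positive definite, F is differentiable at (x, y) and the determinant of its Fréchet derivative, a linear endomorphism of V × V, satisfies |det(fderiv ℝ F (x, y))| = det(y + x⁻¹)^(r+1). -/
open Matrix

noncomputable instance matrixNormedAddCommGroup (r : ℕ) :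
    NormedAddCommGroup (Matrix (Fin r) (Fin r) ℝ) :=
  Matrix.normedAddCommGroup

noncomputable instance matrixNormedSpace (r : ℕ) :
    NormedSpace ℝ (Matrix (Fin r) (Fin r) ℝ) :=
  Matrix.normedSpace

/-- The real vector space of symmetric `r × r` real matrices. -/
def symSubmodule (r : ℕ) : Submodule ℝ (Matrix (Fin r) (Fin r) ℝ) where
  carrier := {A | A.IsSymm}
  add_mem' hA hB := hA.add hB
  zero_mem' := Matrix.isSymm_zero
  smul_mem' c _ hA := hA.smul c

theorem symSubmodule_mul_mul_add_mem (r : ℕ) (x y : symSubmodule r) :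
    (y : Matrix (Fin r) (Fin r) ℝ) * x * y + y ∈ symSubmodule r := by
  have hx : (x : Matrix (Fin r) (Fin r) ℝ).IsSymm := x.2
  have hy : (y : Matrix (Fin r) (Fin r) ℝ).IsSymm := y.2
  refine Matrix.IsSymm.add ?_ hy
  simp only [Matrix.IsSymm, Matrix.transpose_mul, hx.eq, hy.eq, Matrix.mul_assoc]

theorem symSubmodule_add_inv_mem (r : ℕ) (x y : symSubmodule r) :
    (y : Matrix (Fin r) (Fin r) ℝ) + (x : Matrix (Fin r) (Fin r) ℝ)⁻¹ ∈ symSubmodule r := by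
  have hx : (x : Matrix (Fin r) (Fin r) ℝ).IsSymm := x.2
  have hy : (y : Matrix (Fin r) (Fin r) ℝ).IsSymm := y.2
  refine Matrix.IsSymm.add hy ?_
  unfold Matrix.IsSymm
  rw [Matrix.transpose_nonsing_inv, hx.eq]

/-- The map `(x, y) ↦ (y·x·y + y, y + x⁻¹)` on pairs of symmetric matrices. -/
noncomputable def Fsym (r : ℕ) :
    symSubmodule r × symSubmodule r → symSubmodule r × symSubmodule r :=
  fun q =>
    (⟨(q.2 : Matrix (Fin r) (Fin r) ℝ) * q.1 * q.2 + q.2,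
        symSubmodule_mul_mul_add_mem r q.1 q.2⟩,
      ⟨(q.2 : Matrix (Fin r) (Fin r) ℝ) + (q.1 : Matrix (Fin r) (Fin r) ℝ)⁻¹,
        symSubmodule_add_inv_mem r q.1 q.2⟩)

theorem hasFDerivAt_ringInverse_of_finiteDimensional {R : Type*} [NormedRing R]
    [NormedAlgebra ℝ R] [FiniteDimensional ℝ R] (u : Rˣ) :
    HasFDerivAt Ring.inverse (-ContinuousLinearMap.mulLeftRight ℝ R ↑u⁻¹ ↑u⁻¹) (u : R) :=
  have := FiniteDimensional.complete ℝ R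
  hasFDerivAt_ringInverse u

/-- The inverse of a square real matrix is differentiable at an invertible matrix `X`, with
derivative `H ↦ -X⁻¹ * H * X⁻¹`. -/
theorem exists_hasFDerivAt_matrix_inv {r : ℕ} {X : Matrix (Fin r) (Fin r) ℝ} (hX : IsUnit X) :
    ∃ L : Matrix (Fin r) (Fin r) ℝ →L[ℝ] Matrix (Fin r) (Fin r) ℝ,
      (∀ H, L H = -(X⁻¹ * H * X⁻¹)) ∧
        HasFDerivAt (fun A : Matrix (Fin r) (Fin r) ℝ => A⁻¹) L X := by
  obtain ⟨u, rfl⟩ := hX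
  let _ := Matrix.linftyOpNormedRing (n := Fin r) (α := ℝ)
  let _ := Matrix.linftyOpNormedAlgebra (R := ℝ) (n := Fin r) (α := ℝ)
  refine ⟨-ContinuousLinearMap.mulLeftRight ℝ (Matrix (Fin r) (Fin r) ℝ) ↑u⁻¹ ↑u⁻¹,
    fun H => ?_, ?_⟩
  · rw [← Matrix.coe_units_inv]
    rfl
  · have h := hasFDerivAt_ringInverse_of_finiteDimensional u
    have e : (fun A : Matrix (Fin r) (Fin r) ℝ => A⁻¹) = Ring.inverse := by
      funext A
      exact Matrix.nonsing_inv_eq_ringInverse A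
    rw [e]
    exact h

/-- Multiplication of square real matrices as a continuous bilinear map. -/
noncomputable def matrixMulCLM (r : ℕ) :
    Matrix (Fin r) (Fin r) ℝ →L[ℝ] Matrix (Fin r) (Fin r) ℝ →L[ℝ] Matrix (Fin r) (Fin r) ℝ :=
  (LinearMap.toContinuousLinearMap.toLinearMap ∘ₗ
    LinearMap.mul ℝ (Matrix (Fin r) (Fin r) ℝ)).toContinuousLinearMap

@[simp]
theorem matrixMulCLM_apply {r : ℕ} (A B : Matrix (Fin r) (Fin r) ℝ) :
    matrixMulCLM r A B = A * B := rfl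

/-- There is a continuous linear retraction onto the symmetric matrices. -/
theorem exists_retraction_symSubmodule (r : ℕ) :
    ∃ p : Matrix (Fin r) (Fin r) ℝ →L[ℝ] symSubmodule r, ∀ A : symSubmodule r, p A = A := by
  obtain ⟨p, hp⟩ := (symSubmodule r).subtype.exists_leftInverse_of_injective
    (LinearMap.ker_eq_bot.2 (symSubmodule r).injective_subtype)
  exact ⟨p.toContinuousLinearMap, fun A => LinearMap.congr_fun hp A⟩

/-- The congruence action `S ↦ A * S * Aᵀ` of a square matrix on symmetric matrices. -/
def symCongr {r : ℕ} (A : Matrix (Fin r) (Fin r) ℝ) : symSubmodule r →ₗ[ℝ] symSubmodule r where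
  toFun S := ⟨A * S * Aᵀ, by
    have hS : (S : Matrix (Fin r) (Fin r) ℝ)ᵀ = S := S.2
    change (A * (S : Matrix (Fin r) (Fin r) ℝ) * Aᵀ)ᵀ = _
    simp [Matrix.transpose_mul, hS, Matrix.mul_assoc]⟩
  map_add' S T := by
    ext1
    simp [Matrix.mul_add, Matrix.add_mul]
  map_smul' c S := by
    ext1
    simp

@[simp]
theorem coe_symCongr {r : ℕ} (A : Matrix (Fin r) (Fin r) ℝ) (S : symSubmodule r) :
    (symCongr A S : Matrix (Fin r) (Fin r) ℝ) = A * S * Aᵀ := rfl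

theorem symCongr_one (r : ℕ) : symCongr (1 : Matrix (Fin r) (Fin r) ℝ) = LinearMap.id := by
  ext1 S
  ext1
  simp

theorem symCongr_mul {r : ℕ} (A B : Matrix (Fin r) (Fin r) ℝ) :
    symCongr (A * B) = symCongr A ∘ₗ symCongr B := by
  ext1 S
  ext1
  simp [Matrix.transpose_mul, Matrix.mul_assoc]

/-- A symmetric matrix is determined by its upper triangular entries. -/
def symEquivUpper (r : ℕ) : symSubmodule r ≃ₗ[ℝ] ({p : Fin r × Fin r // p.1 ≤ p.2} → ℝ) where
  toFun A p := (A : Matrix (Fin r) (Fin r) ℝ) p.1.1 p.1.2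
  map_add' _ _ := rfl
  map_smul' _ _ := rfl
  invFun f := ⟨Matrix.of fun i j =>
    if h : i ≤ j then f ⟨(i, j), h⟩ else f ⟨(j, i), (not_le.1 h).le⟩, by
      refine Matrix.IsSymm.ext fun i j => ?_
      rcases lt_trichotomy i j with h | rfl | h
      · simp [h.le, h.not_ge]
      · rfl
      · simp [h.le, h.not_ge]⟩
  left_inv A := by
    ext i j
    have hA : (A : Matrix (Fin r) (Fin r) ℝ).IsSymm := A.2
    by_cases h : i ≤ j
    · simp [h]
    · simp [h, hA.apply i j]
  right_inv f := by
    ext ⟨⟨i, j⟩, h⟩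
    have h' : i ≤ j := h
    simp [h']

@[simp]
theorem symEquivUpper_apply {r : ℕ} (A : symSubmodule r)
    (p : {p : Fin r × Fin r // p.1 ≤ p.2}) :
    symEquivUpper r A p = (A : Matrix (Fin r) (Fin r) ℝ) p.1.1 p.1.2 := rfl

theorem prod_upper_mul {r : ℕ} (d : Fin r → ℝ) :
    ∏ p : {p : Fin r × Fin r // p.1 ≤ p.2}, d p.1.1 * d p.1.2 = (∏ i, d i) ^ (r + 1) := by
  have hsplit : ∏ p : {p : Fin r × Fin r // p.1 ≤ p.2}, d p.1.1 * d p.1.2 =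
      ∏ i, ∏ j, if i ≤ j then d i * d j else 1 := by
    rw [← Fintype.prod_prod_type', ← Finset.prod_filter]
    exact (Finset.prod_subtype _ (by simp) fun p : Fin r × Fin r => d p.1 * d p.2).symm
  have hfactor : ∀ i j : Fin r, (if i ≤ j then d i * d j else 1) =
      (if i ≤ j then d i else 1) * (if i ≤ j then d j else 1) := by
    intro i j
    split_ifs <;> simp
  have hmerge : ∀ i j : Fin r, (if i ≤ j then d i else 1) * (if j ≤ i then d i else 1) =
      d i * (if i = j then d i else 1) := by
    intro i j
    rcases lt_trichotomy i j with h | rfl | h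
    · simp [h.le, h.not_ge, h.ne]
    · simp
    · simp [h.le, h.not_ge, h.ne']
  rw [hsplit]
  simp_rw [hfactor, Finset.prod_mul_distrib]
  rw [Finset.prod_comm (f := fun i j : Fin r => if i ≤ j then d j else 1)]
  simp_rw [← Finset.prod_mul_distrib, hmerge, Finset.prod_mul_distrib]
  simp [Finset.prod_pow, pow_succ]

theorem det_symCongr_diagonal {r : ℕ} (d : Fin r → ℝ) :
    LinearMap.det (symCongr (Matrix.diagonal d)) = (∏ i, d i) ^ (r + 1) := by
  have hconj : (symEquivUpper r).toLinearMap ∘ₗ symCongr (Matrix.diagonal d) ∘ₗ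
      (symEquivUpper r).symm.toLinearMap =
      LinearMap.pi fun p : {p : Fin r × Fin r // p.1 ≤ p.2} =>
        LinearMap.mulLeft ℝ (d p.1.1 * d p.1.2) ∘ₗ LinearMap.proj p := by
    refine LinearMap.ext fun f => ?_
    obtain ⟨S, rfl⟩ := (symEquivUpper r).surjective f
    ext p
    simp only [LinearMap.comp_apply, LinearEquiv.coe_coe, LinearEquiv.symm_apply_apply,
      LinearMap.pi_apply, LinearMap.proj_apply, LinearMap.mulLeft_apply, symEquivUpper_apply,
      coe_symCongr, Matrix.diagonal_transpose, Matrix.mul_diagonal, Matrix.diagonal_mul]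
    ring
  rw [← LinearMap.det_conj _ (symEquivUpper r), hconj, LinearMap.det_pi]
  simp only [LinearMap.det_mulLeft]
  exact prod_upper_mul d

/-- The quadratic representation of a symmetric matrix `w` has determinant `det w ^ (r + 1)`. -/
theorem det_symCongr_of_isSymm {r : ℕ} {w : Matrix (Fin r) (Fin r) ℝ} (hw : w.IsSymm) :
    LinearMap.det (symCongr w) = w.det ^ (r + 1) := by
  have hH : w.IsHermitian := by
    rw [Matrix.IsHermitian, Matrix.conjTranspose_eq_transpose_of_trivial, hw.eq]
  set U : Matrix (Fin r) (Fin r) ℝ := (hH.eigenvectorUnitary : Matrix (Fin r) (Fin r) ℝ)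
  have hU : U * star U = 1 := Unitary.coe_mul_star_self hH.eigenvectorUnitary
  have hspec : w = U * Matrix.diagonal hH.eigenvalues * star U := by
    have h := hH.spectral_theorem
    rwa [Unitary.conjStarAlgAut_apply] at h
  have hdetU : LinearMap.det (symCongr U) * LinearMap.det (symCongr (star U)) = 1 := by
    rw [← LinearMap.det_comp, ← symCongr_mul, hU, symCongr_one, LinearMap.det_id]
  have hdet : w.det = ∏ i, hH.eigenvalues i := by
    simpa using hH.det_eq_prod_eigenvalues
  calc LinearMap.det (symCongr w)
      = LinearMap.det (symCongr (U * Matrix.diagonal hH.eigenvalues * star U)) :=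
        congrArg (fun A => LinearMap.det (symCongr A)) hspec
    _ = LinearMap.det (symCongr (Matrix.diagonal hH.eigenvalues)) := by
        rw [symCongr_mul, symCongr_mul, LinearMap.det_comp, LinearMap.det_comp, mul_right_comm,
          hdetU, one_mul]
    _ = w.det ^ (r + 1) := by rw [det_symCongr_diagonal, hdet]

/-- Schur complement formula for an endomorphism of a product given in block form. -/
theorem det_prod_coprod_id {K M N : Type*} [Field K] [AddCommGroup M] [Module K M]
    [AddCommGroup N] [Module K N] [FiniteDimensional K M] [FiniteDimensional K N]
    (A : M →ₗ[K] M) (B : N →ₗ[K] M) (C : M →ₗ[K] N) :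
    LinearMap.det ((A.coprod B).prod (C.coprod LinearMap.id)) =
      LinearMap.det (A - B ∘ₗ C) := by
  classical
  let b := Module.finBasis K M
  let c := Module.finBasis K N
  have hblocks : LinearMap.toMatrix (b.prod c) (b.prod c)
      ((A.coprod B).prod (C.coprod LinearMap.id)) =
      Matrix.fromBlocks (LinearMap.toMatrix b b A) (LinearMap.toMatrix c b B)
        (LinearMap.toMatrix b c C) 1 := by
    ext (i | i) (j | j) <;>
      simp [LinearMap.toMatrix_apply, Matrix.one_apply, Finsupp.single_apply, eq_comm]
  rw [← LinearMap.det_toMatrix (b.prod c), hblocks, Matrix.det_fromBlocks_one₂₂,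
    ← LinearMap.toMatrix_comp, ← map_sub, LinearMap.det_toMatrix]

/-- The derivative of `Fsym r` at a point whose first component is invertible. -/
theorem exists_hasFDerivAt_Fsym {r : ℕ} (x y : symSubmodule r)
    (hx : IsUnit (x : Matrix (Fin r) (Fin r) ℝ)) :
    ∃ D : symSubmodule r × symSubmodule r →L[ℝ] symSubmodule r × symSubmodule r,
      HasFDerivAt (Fsym r) D (x, y) ∧ ∀ u v : symSubmodule r,
        ((D (u, v)).1 : Matrix (Fin r) (Fin r) ℝ) = v * x * y + y * u * y + y * x * v + v ∧
        ((D (u, v)).2 : Matrix (Fin r) (Fin r) ℝ) =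
          v - (x : Matrix (Fin r) (Fin r) ℝ)⁻¹ * u * (x : Matrix (Fin r) (Fin r) ℝ)⁻¹ := by
  obtain ⟨L, hL, hinv⟩ := exists_hasFDerivAt_matrix_inv hx
  obtain ⟨p, hp⟩ := exists_retraction_symSubmodule r
  have hmem_fst (u v : symSubmodule r) :
      (v : Matrix (Fin r) (Fin r) ℝ) * x * y + y * u * y + y * x * v + v ∈ symSubmodule r := by
    have hx' : (x : Matrix (Fin r) (Fin r) ℝ)ᵀ = x := x.2
    have hy' : (y : Matrix (Fin r) (Fin r) ℝ)ᵀ = y := y.2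
    have hu' : (u : Matrix (Fin r) (Fin r) ℝ)ᵀ = u := u.2
    have hv' : (v : Matrix (Fin r) (Fin r) ℝ)ᵀ = v := v.2
    change (_ : Matrix (Fin r) (Fin r) ℝ)ᵀ = _
    simp only [Matrix.transpose_add, Matrix.transpose_mul, hx', hy', hu', hv', Matrix.mul_assoc]
    abel
  have hmem_snd (u v : symSubmodule r) :
      (v : Matrix (Fin r) (Fin r) ℝ) -
        (x : Matrix (Fin r) (Fin r) ℝ)⁻¹ * u * (x : Matrix (Fin r) (Fin r) ℝ)⁻¹ ∈
          symSubmodule r := by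
    have hx' : (x : Matrix (Fin r) (Fin r) ℝ)ᵀ = x := x.2
    have hu' : (u : Matrix (Fin r) (Fin r) ℝ)ᵀ = u := u.2
    have hv' : (v : Matrix (Fin r) (Fin r) ℝ)ᵀ = v := v.2
    change (_ : Matrix (Fin r) (Fin r) ℝ)ᵀ = _
    simp only [Matrix.transpose_sub, Matrix.transpose_mul, Matrix.transpose_nonsing_inv,
      hx', hu', hv', Matrix.mul_assoc]
  let i := (symSubmodule r).subtypeL
  let X := i ∘L ContinuousLinearMap.fst ℝ (symSubmodule r) (symSubmodule r)
  let Y := i ∘L ContinuousLinearMap.snd ℝ (symSubmodule r) (symSubmodule r)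
  have hX : HasFDerivAt X X (x, y) := X.hasFDerivAt
  have hY : HasFDerivAt Y Y (x, y) := Y.hasFDerivAt
  have hYXY := ((matrixMulCLM r).hasFDerivAt_of_bilinear
    ((matrixMulCLM r).hasFDerivAt_of_bilinear hY hX) hY).add hY
  have hXinv := hY.add (HasFDerivAt.comp (x, y) (f := X) (g := fun A => A⁻¹) hinv hX)
  have h := (p.hasFDerivAt.comp (x, y) hYXY).prodMk (p.hasFDerivAt.comp (x, y) hXinv)
  refine ⟨_, h.congr_of_eventuallyEq (.of_forall fun q => ?_), fun u v => ⟨?_, ?_⟩⟩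
  · exact Prod.ext (hp (Fsym r q).1).symm (hp (Fsym r q).2).symm
  · have hD : p (v * x * y + y * u * y + y * x * v + v) = (⟨_, hmem_fst u v⟩ : symSubmodule r) :=
      hp ⟨_, hmem_fst u v⟩
    have hsum : (y : Matrix (Fin r) (Fin r) ℝ) * x * v + (y * u + v * x) * y + v =
        v * x * y + y * u * y + y * x * v + v := by
      rw [Matrix.add_mul]
      abel
    exact congrArg Subtype.val ((congrArg p hsum).trans hD)
  · have hD : p (v - (x : Matrix (Fin r) (Fin r) ℝ)⁻¹ * u * (x : Matrix (Fin r) (Fin r) ℝ)⁻¹) =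
        (⟨_, hmem_snd u v⟩ : symSubmodule r) := hp ⟨_, hmem_snd u v⟩
    have hsum : (v : Matrix (Fin r) (Fin r) ℝ) + L u =
        v - (x : Matrix (Fin r) (Fin r) ℝ)⁻¹ * u * (x : Matrix (Fin r) (Fin r) ℝ)⁻¹ := by
      rw [hL, sub_eq_add_neg]
    exact congrArg Subtype.val ((congrArg p hsum).trans hD)

/-- The Jacobian of the change of variables `(x, y) ↦ (y·x·y + y, y + x⁻¹)` on the space of
symmetric `r × r` real matrices: at a pair of positive definite matrices the map is
differentiable and the absolute value of the determinant of its Fréchet derivative equals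
`det (y + x⁻¹) ^ (r + 1)`. -/
theorem stmt_3 (r : ℕ) (hr : 1 ≤ r) (x y : symSubmodule r)
    (hx : (x : Matrix (Fin r) (Fin r) ℝ).PosDef)
    (hy : (y : Matrix (Fin r) (Fin r) ℝ).PosDef) :
    DifferentiableAt ℝ (Fsym r) (x, y) ∧
      |LinearMap.det ((fderiv ℝ (Fsym r) (x, y)).toLinearMap)| =
        ((y : Matrix (Fin r) (Fin r) ℝ) + (x : Matrix (Fin r) (Fin r) ℝ)⁻¹).det ^ (r + 1) := by
  obtain ⟨D, hD, hD'⟩ := exists_hasFDerivAt_Fsym x y hx.isUnit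
  refine ⟨hD.differentiableAt, ?_⟩
  rw [hD.fderiv]
  set w : Matrix (Fin r) (Fin r) ℝ := y + (x : Matrix (Fin r) (Fin r) ℝ)⁻¹ with hw
  have hwsymm : w.IsSymm := symSubmodule_add_inv_mem r x y
  let E : symSubmodule r × symSubmodule r →ₗ[ℝ] symSubmodule r × symSubmodule r := D
  let A := LinearMap.fst ℝ _ _ ∘ₗ E ∘ₗ LinearMap.inl ℝ _ _
  let B := LinearMap.fst ℝ _ _ ∘ₗ E ∘ₗ LinearMap.inr ℝ _ _
  let C := LinearMap.snd ℝ _ _ ∘ₗ E ∘ₗ LinearMap.inl ℝ _ _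
  have hE : E = (A.coprod B).prod (C.coprod LinearMap.id) := by
    refine LinearMap.ext fun q => ?_
    obtain ⟨u, v⟩ := q
    ext1 <;> ext1
    · simp [A, B, C, E, hD']
      abel
    · simp [A, B, C, E, hD']
      abel
  have hdet : IsUnit (x : Matrix (Fin r) (Fin r) ℝ).det := hx.det_pos.ne'.isUnit
  have hschur : A - B ∘ₗ C = symCongr w := by
    refine LinearMap.ext fun u => ?_
    ext1
    rw [coe_symCongr, hwsymm.eq]
    simp [A, B, C, E, hD', hw, Matrix.mul_add, Matrix.add_mul, Matrix.mul_assoc]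
    rw [Matrix.nonsing_inv_mul_cancel_left _ _ hdet, Matrix.mul_nonsing_inv_cancel_left _ _ hdet]
    abel
  rw [show (D : symSubmodule r × symSubmodule r →ₗ[ℝ] symSubmodule r × symSubmodule r) = E from rfl,
    hE, det_prod_coprod_id, hschur, det_symCongr_of_isSymm hwsymm, abs_of_nonneg]
  exact pow_nonneg (hy.add hx.inv).det_pos.le _
end

section
/- Fix p ∈ ℝ and a, ν₁, ν₂ > 0. Let μ be the product probability measure GIG(p; a⁻¹, ν₁) ⊗ GIG(p; ν₁, ν₂) on ℝ × ℝ, with first coordinate x and second coordinate w. Then Measure.map (fun (x, w) => ((w + x⁻¹)²·a, w²·x + w)) μ = Measure.bind (Measure.map (fun (x, w) => (w + x⁻¹)²·a) μ) (fun b => Measure.map (fun u => (b, u)) (GIG(p; b⁻¹, ν₂))). Equivalently: if X ~ GIG(p; a⁻¹, ν₁) and w ~ GIG(p; ν₁, ν₂) are independent, then the conditional law of w²·X + w given (w + X⁻¹)²·a = b is GIG(p; b⁻¹, ν₂). -/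
open MeasureTheory

/-- Unnormalized density of the generalized inverse Gaussian distribution `GIG(p; a, b)`:
`x ↦ x^(p-1) · exp(-(a·x + b/x)/2)` on `(0, ∞)`, and `0` elsewhere. -/
noncomputable def gigDensity (p a b : ℝ) (x : ℝ) : ENNReal :=
  if 0 < x then ENNReal.ofReal (x ^ (p - 1) * Real.exp (-(a * x + b / x) / 2)) else 0

/-- The (scalar) generalized inverse Gaussian distribution `GIG(p; a, b)`: the normalized
measure on `ℝ` with density proportional to `x ↦ x^(p-1) · exp(-(a·x + b/x)/2)` on `(0, ∞)`. -/
noncomputable def GIG (p a b : ℝ) : Measure ℝ :=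
  ((volume.withDensity (gigDensity p a b)) Set.univ)⁻¹ • volume.withDensity (gigDensity p a b)

lemma measurable_gigDensity {α : Type*} [MeasurableSpace α] (p b : ℝ) {f g : α → ℝ}
    (hf : Measurable f) (hg : Measurable g) :
    Measurable fun z => gigDensity p (f z) b (g z) := by
  unfold gigDensity
  refine Measurable.ite (measurableSet_lt measurable_const hg) ?_ measurable_const
  have := hg.pow_const (p - 1)
  fun_prop

lemma measurable_gigDensity_const (p a b : ℝ) : Measurable (gigDensity p a b) :=
  measurable_gigDensity p b measurable_const measurable_id

lemma lintegral_gigDensity_ne_zero (p a b : ℝ) : ∫⁻ x, gigDensity p a b x ≠ 0 := by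
  have hm := measurable_gigDensity_const p a b
  rw [← pos_iff_ne_zero, lintegral_pos_iff_support hm]
  refine lt_of_lt_of_le (b := volume (Set.Ioi (0 : ℝ))) (by simp) (measure_mono fun x hx => ?_)
  have hx' : 0 < x := hx
  have : 0 < x ^ (p - 1) * Real.exp (-(a * x + b / x) / 2) := by positivity
  simpa [gigDensity, hx'] using this

lemma lintegral_gigDensity_ne_top (p : ℝ) {a b : ℝ} (ha : 0 < a) (hb : 0 < b) :
    ∫⁻ x, gigDensity p a b x ≠ ⊤ := by
  obtain ⟨n, hn⟩ := exists_nat_gt (-p)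
  set C : ℝ := n.factorial * (2 / b) ^ n
  have hInt : IntegrableOn (fun x : ℝ => C * (x ^ (p - 1 + n) * Real.exp (-(a / 2) * x ^ (1 : ℝ))))
      (Set.Ioi 0) :=
    (integrableOn_rpow_mul_exp_neg_mul_rpow (by linarith) one_pos (by positivity)).const_mul C
  refine ne_top_of_le_ne_top hInt.lintegral_lt_top.ne ?_
  rw [← lintegral_indicator measurableSet_Ioi]
  refine lintegral_mono fun x => ?_
  by_cases hx : 0 < x
  · simp only [gigDensity, hx, if_true, Set.indicator_of_mem (Set.mem_Ioi.2 hx)]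
    refine ENNReal.ofReal_le_ofReal ?_
    have hexp : Real.exp (-(b / x / 2)) ≤ C * x ^ n := by
      have h := Real.pow_div_factorial_le_exp (x := b / x / 2) (by positivity) n
      have hf : (0 : ℝ) < n.factorial := by positivity
      rw [Real.exp_neg]
      calc (Real.exp (b / x / 2))⁻¹ ≤ ((b / x / 2) ^ n / n.factorial)⁻¹ :=
            inv_anti₀ (by positivity) h
        _ = C * x ^ n := by
            simp only [C, div_pow]
            field_simp
    rw [show -(a * x + b / x) / 2 = -(a / 2) * x + -(b / x / 2) by ring, Real.exp_add,
      Real.rpow_one, Real.rpow_add_natCast hx.ne']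
    calc x ^ (p - 1) * (Real.exp (-(a / 2) * x) * Real.exp (-(b / x / 2)))
        ≤ x ^ (p - 1) * (Real.exp (-(a / 2) * x) * (C * x ^ n)) := by gcongr
      _ = _ := by ring
  · simp [gigDensity, hx]

instance GIG.instSFinite (p a b : ℝ) : SFinite (GIG p a b) := by
  unfold GIG
  infer_instance

lemma lintegral_GIG (p a b : ℝ) {f : ℝ → ENNReal} (hf : Measurable f) :
    ∫⁻ x, f x ∂(GIG p a b) =
      (∫⁻ x, gigDensity p a b x)⁻¹ * ∫⁻ x, gigDensity p a b x * f x := by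
  have hm := measurable_gigDensity_const p a b
  rw [GIG, lintegral_smul_measure, lintegral_withDensity_eq_lintegral_mul _ hm hf,
    withDensity_apply _ MeasurableSet.univ, Measure.restrict_univ]
  rfl

lemma lintegral_eq_lintegral_comp_mul_add {r : ℝ} (hr : 0 < r) (t : ℝ) {f : ℝ → ENNReal}
    (hf : Measurable f) :
    ∫⁻ x, f x = ENNReal.ofReal r * ∫⁻ u, f (r * u + t) := by
  rw [← lintegral_add_right_eq_self f t]
  conv_lhs => rw [← Real.smul_map_volume_mul_left hr.ne']
  rw [lintegral_smul_measure, lintegral_map (by fun_prop) (by fun_prop), abs_of_pos hr, smul_eq_mul]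

/-- Change of variables `(x, w) = (u / s² + 1 / s, s - 1 / x)`, for functions vanishing
where `w + 1 / x` is not positive. -/
lemma lintegral_lintegral_add_inv {F : ℝ → ℝ → ENNReal} (hF : Measurable (Function.uncurry F))
    (h0 : ∀ x w, w + x⁻¹ ≤ 0 → F x w = 0) :
    ∫⁻ x, ∫⁻ w, F x w = ∫⁻ s, if 0 < s then ENNReal.ofReal (s ^ 2)⁻¹ *
      ∫⁻ u, F ((s ^ 2)⁻¹ * u + s⁻¹) (s - ((s ^ 2)⁻¹ * u + s⁻¹)⁻¹) else 0 := by
  have hG : Measurable fun z : ℝ × ℝ => F z.1 (z.2 - z.1⁻¹) :=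
    hF.comp (measurable_fst.prodMk (measurable_snd.sub measurable_fst.inv))
  simp_rw [fun x : ℝ => (lintegral_sub_right_eq_self (μ := volume) (F x) x⁻¹).symm]
  rw [lintegral_lintegral_swap hG.aemeasurable]
  refine lintegral_congr fun s => ?_
  split_ifs with hs
  · exact lintegral_eq_lintegral_comp_mul_add (by positivity) _
      (hG.comp (measurable_id.prodMk measurable_const))
  · have h (x : ℝ) : F x (s - x⁻¹) = 0 := h0 _ _ (by simpa using hs)
    simp [h]

/-- The factor depending only on `s = w + x⁻¹` in the joint density of `(s, w² x + w)`; the other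
factor is `gigDensity p (s² a)⁻¹ ν₂`. -/
noncomputable def gigTransferWeight (p a ν₁ ν₂ s : ℝ) : ENNReal :=
  if 0 < s then ENNReal.ofReal (s ^ 2)⁻¹ * ENNReal.ofReal
    ((s ^ (p - 1))⁻¹ * Real.exp (-(a⁻¹ / s + ν₁ * s + ν₂ / s) / 2)) else 0

lemma gigDensity_mul_gigDensity (p ν₁ ν₂ : ℝ) {a s : ℝ} (ha : 0 < a) (hs : 0 < s) (u : ℝ) :
    gigDensity p a⁻¹ ν₁ ((s ^ 2)⁻¹ * u + s⁻¹) *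
        gigDensity p ν₁ ν₂ (s - ((s ^ 2)⁻¹ * u + s⁻¹)⁻¹) =
      ENNReal.ofReal ((s ^ (p - 1))⁻¹ * Real.exp (-(a⁻¹ / s + ν₁ * s + ν₂ / s) / 2)) *
        gigDensity p (s ^ 2 * a)⁻¹ ν₂ u := by
  have hx : (s ^ 2)⁻¹ * u + s⁻¹ = (u + s) / s ^ 2 := by field_simp
  rw [hx]
  by_cases hus : 0 < u + s
  · have hw : s - ((u + s) / s ^ 2)⁻¹ = u * s / (u + s) := by field_simp; ring
    rw [hw]
    by_cases hu : 0 < u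
    · have hx0 : 0 < (u + s) / s ^ 2 := by positivity
      have hw0 : 0 < u * s / (u + s) := by positivity
      simp only [gigDensity, hx0, hw0, hu, if_true]
      rw [← ENNReal.ofReal_mul (by positivity), ← ENNReal.ofReal_mul (by positivity)]
      congr 1
      rw [mul_mul_mul_comm, mul_mul_mul_comm (s ^ (p - 1))⁻¹, ← Real.exp_add, ← Real.exp_add,
        ← Real.mul_rpow hx0.le hw0.le, ← Real.inv_rpow hs.le,
        ← Real.mul_rpow (by positivity) hu.le]
      congr 2
      · field_simp
      · field_simp
        ring
    · have hw0 : ¬ 0 < u * s / (u + s) := by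
        rw [not_lt] at hu ⊢
        exact div_nonpos_of_nonpos_of_nonneg (mul_nonpos_of_nonpos_of_nonneg hu hs.le) hus.le
      simp [gigDensity, hw0, hu]
  · have hx0 : ¬ 0 < (u + s) / s ^ 2 := by
      rw [not_lt] at hus ⊢
      exact div_nonpos_of_nonpos_of_nonneg hus (by positivity)
    have hu : ¬ 0 < u := fun h => hus (by positivity)
    simp only [gigDensity, hx0, hu, if_false, mul_zero, zero_mul]

lemma lintegral_gigDensity_transfer (p ν₁ ν₂ : ℝ) {a : ℝ} (ha : 0 < a)
    {f : ℝ × ℝ → ENNReal} (hf : Measurable f) :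
    ∫⁻ x, ∫⁻ w, gigDensity p a⁻¹ ν₁ x * gigDensity p ν₁ ν₂ w *
        f ((w + x⁻¹) ^ 2 * a, w ^ 2 * x + w) =
      ∫⁻ s, gigTransferWeight p a ν₁ ν₂ s *
        ∫⁻ u, gigDensity p (s ^ 2 * a)⁻¹ ν₂ u * f (s ^ 2 * a, u) := by
  have h₁ : Measurable fun z : ℝ × ℝ => gigDensity p a⁻¹ ν₁ z.1 :=
    measurable_gigDensity p ν₁ measurable_const measurable_fst
  have h₂ : Measurable fun z : ℝ × ℝ => gigDensity p ν₁ ν₂ z.2 :=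
    measurable_gigDensity p ν₂ measurable_const measurable_snd
  rw [lintegral_lintegral_add_inv]
  · refine lintegral_congr fun s => ?_
    unfold gigTransferWeight
    split_ifs with hs
    · rw [mul_assoc]
      congr 1
      rw [← lintegral_const_mul]
      · refine lintegral_congr fun u => ?_
        rw [gigDensity_mul_gigDensity p ν₁ ν₂ ha hs, mul_assoc]
        by_cases hu : 0 < u
        · congr 4
          · ring
          · have : (s ^ 2)⁻¹ * u + s⁻¹ ≠ 0 := by positivity
            generalize hx : (s ^ 2)⁻¹ * u + s⁻¹ = x at this
            have hu' : u = s ^ 2 * x - s := by rw [← hx]; field_simp; ring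
            rw [hu']
            field_simp
            ring
        · simp [gigDensity, hu]
      · exact (measurable_gigDensity_const p _ ν₂).mul
          (hf.comp (measurable_const.prodMk measurable_id))
    · simp
  · exact (h₁.mul h₂).mul (hf.comp (by fun_prop))
  · intro x w h
    by_cases hx : 0 < x
    · have hw : ¬ 0 < w := fun hw => absurd h (by rw [not_le]; positivity)
      simp [gigDensity, hw]
    · simp [gigDensity, hx]

lemma lintegral_GIG_prod_GIG (p ν₁ ν₂ : ℝ) {a : ℝ} (ha : 0 < a)
    {f : ℝ × ℝ → ENNReal} (hf : Measurable f) :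
    ∫⁻ q, f ((q.2 + q.1⁻¹) ^ 2 * a, q.2 ^ 2 * q.1 + q.2) ∂((GIG p a⁻¹ ν₁).prod (GIG p ν₁ ν₂)) =
      (∫⁻ x, gigDensity p a⁻¹ ν₁ x)⁻¹ * ((∫⁻ w, gigDensity p ν₁ ν₂ w)⁻¹ *
        ∫⁻ s, gigTransferWeight p a ν₁ ν₂ s *
          ∫⁻ u, gigDensity p (s ^ 2 * a)⁻¹ ν₂ u * f (s ^ 2 * a, u)) := by
  have hg : Measurable fun q : ℝ × ℝ => f ((q.2 + q.1⁻¹) ^ 2 * a, q.2 ^ 2 * q.1 + q.2) :=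
    hf.comp (by fun_prop)
  have h₂ : Measurable fun z : ℝ × ℝ => gigDensity p ν₁ ν₂ z.2 :=
    measurable_gigDensity p ν₂ measurable_const measurable_snd
  have h₁ := measurable_gigDensity_const p a⁻¹ ν₁
  have hfx (x : ℝ) : Measurable fun w : ℝ => f ((w + x⁻¹) ^ 2 * a, w ^ 2 * x + w) :=
    hf.comp (by fun_prop)
  rw [lintegral_prod _ hg.aemeasurable, lintegral_GIG _ _ _ hg.lintegral_prod_right',
    ← lintegral_gigDensity_transfer p ν₁ ν₂ ha hf]
  congr 1
  have h₃ : Measurable fun x => gigDensity p a⁻¹ ν₁ x * ∫⁻ w, gigDensity p ν₁ ν₂ w *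
      f ((w + x⁻¹) ^ 2 * a, w ^ 2 * x + w) :=
    h₁.mul (h₂.mul hg).lintegral_prod_right'
  simp_rw [fun x => lintegral_GIG p ν₁ ν₂ (hfx x), mul_left_comm (gigDensity p a⁻¹ ν₁ _)]
  rw [lintegral_const_mul _ h₃]
  congr 1
  refine lintegral_congr fun x => ?_
  have h₄ : Measurable fun w => gigDensity p ν₁ ν₂ w *
      f ((w + x⁻¹) ^ 2 * a, w ^ 2 * x + w) :=
    (measurable_gigDensity_const p ν₁ ν₂).mul (hfx x)
  rw [← lintegral_const_mul _ h₄]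
  simp_rw [mul_assoc]

/-- One-step conditional law: if `X ~ GIG(p; a⁻¹, ν₁)` and `w ~ GIG(p; ν₁, ν₂)` are
independent, then the conditional law of `w²·X + w` given `(w + X⁻¹)²·a = b` is
`GIG(p; b⁻¹, ν₂)`, expressed via `Measure.map` and `Measure.bind`. -/
theorem stmt_4 (p a ν₁ ν₂ : ℝ) (ha : 0 < a) (hν₁ : 0 < ν₁) (hν₂ : 0 < ν₂)
    (μ : Measure (ℝ × ℝ)) (hμ : μ = (GIG p a⁻¹ ν₁).prod (GIG p ν₁ ν₂)) :
    Measure.map (fun q : ℝ × ℝ => ((q.2 + q.1⁻¹) ^ 2 * a, q.2 ^ 2 * q.1 + q.2)) μ =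
      Measure.bind (Measure.map (fun q : ℝ × ℝ => (q.2 + q.1⁻¹) ^ 2 * a) μ)
        (fun b => Measure.map (fun u => (b, u)) (GIG p b⁻¹ ν₂)) := by
  subst hμ
  have hmeas : Measurable fun q : ℝ × ℝ => (q.2 + q.1⁻¹) ^ 2 * a := by fun_prop
  have hker : Measurable fun b => Measure.map (fun u => (b, u)) (GIG p b⁻¹ ν₂) := by
    refine Measure.measurable_of_measurable_coe _ fun s hs => ?_
    have h (b : ℝ) : Measure.map (fun u => (b, u)) (GIG p b⁻¹ ν₂) s =
        (∫⁻ x, gigDensity p b⁻¹ ν₂ x)⁻¹ *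
          ∫⁻ x, gigDensity p b⁻¹ ν₂ x * s.indicator 1 (b, x) := by
      have hb : Measurable fun x => s.indicator (1 : ℝ × ℝ → ENNReal) (b, x) :=
        (measurable_one.indicator hs).comp measurable_prodMk_left
      rw [← lintegral_GIG _ _ _ hb, ← lintegral_indicator_one hs,
        lintegral_map (measurable_one.indicator hs) measurable_prodMk_left]
    simp_rw [h]
    have hm : Measurable fun z : ℝ × ℝ => gigDensity p z.1⁻¹ ν₂ z.2 :=
      measurable_gigDensity p ν₂ measurable_fst.inv measurable_snd
    exact hm.lintegral_prod_right'.inv.mul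
      (hm.mul (measurable_one.indicator hs)).lintegral_prod_right'
  refine Measure.ext_of_lintegral _ fun f hf => ?_
  have hL : Measurable fun b => ∫⁻ y, f y ∂(Measure.map (fun u => (b, u)) (GIG p b⁻¹ ν₂)) :=
    (Measure.measurable_lintegral hf).comp hker
  rw [lintegral_map hf (by fun_prop), Measure.lintegral_bind hker.aemeasurable hf.aemeasurable,
    lintegral_map hL hmeas, lintegral_GIG_prod_GIG p ν₁ ν₂ ha hf]
  refine Eq.trans ?_ (lintegral_GIG_prod_GIG p ν₁ ν₂ ha (hL.comp measurable_fst)).symm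
  congr 2
  refine lintegral_congr fun s => ?_
  by_cases hs : 0 < s
  · congr 1
    simp only [Function.comp_apply]
    rw [lintegral_mul_const _ (measurable_gigDensity_const p _ ν₂),
      lintegral_map hf measurable_prodMk_left,
      lintegral_GIG _ _ _ (f := fun u => f (s ^ 2 * a, u)) (hf.comp measurable_prodMk_left),
      ← mul_assoc, ENNReal.mul_inv_cancel (lintegral_gigDensity_ne_zero _ _ _)
        (lintegral_gigDensity_ne_top p (by positivity) hν₂), one_mul]
  · simp [gigTransferWeight, hs]
end

section
/- Let (B_t)_{t≥0} be a standard one-dimensional Brownian motion on a probability space (Ω, ℙ) (Mathlib's Brownian motion: an almost surely continuous centered Gaussian process with covariance Cov(B_s, B_t) = min(s, t)). Fix p > 0. Then ℙ-almost surely the integral ι_∞(ω) := ∫_0^∞ exp(-2·B_s(ω) - 2·p·s) ds is finite and strictly positive, and the law of the random variable ω ↦ (ι_∞(ω))⁻¹ is Gamma(p, 1/2). Equivalently, ∫_0^∞ exp(-2(B_s + p·s)) ds is distributed as the reciprocal of a Gamma random variable with shape p and rate 1/2. -/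
open MeasureTheory ProbabilityTheory

lemma lintegral_ofReal_exp_mul_eq_tsum {μ : Measure ℝ} (hμ : ∀ᵐ x ∂μ, 0 ≤ x) {t : ℝ}
    (ht : 0 ≤ t) :
    ∫⁻ x, ENNReal.ofReal (Real.exp (t * x)) ∂μ =
      ∑' n : ℕ, ENNReal.ofReal (t ^ n / n.factorial) * ∫⁻ x, ENNReal.ofReal (x ^ n) ∂μ := by
  have h (n : ℕ) : ENNReal.ofReal (t ^ n / n.factorial) * ∫⁻ x, ENNReal.ofReal (x ^ n) ∂μ =
      ∫⁻ x, ENNReal.ofReal (t ^ n / n.factorial) * ENNReal.ofReal (x ^ n) ∂μ :=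
    (lintegral_const_mul _ (by fun_prop)).symm
  simp_rw [h]
  rw [← lintegral_tsum (fun n => by fun_prop)]
  refine lintegral_congr_ae ?_
  filter_upwards [hμ] with x hx
  have hs := NormedSpace.expSeries_div_hasSum_exp (𝔸 := ℝ) (t * x)
  rw [← Real.exp_eq_exp_ℝ] at hs
  rw [← hs.tsum_eq, ENNReal.ofReal_tsum_of_nonneg (fun n => by positivity) hs.summable]
  refine tsum_congr fun n => ?_
  rw [← ENNReal.ofReal_mul (by positivity)]
  congr 1
  ring

lemma integrable_exp_mul_of_lintegral_lt_top {μ : Measure ℝ} {t : ℝ}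
    (h : ∫⁻ x, ENNReal.ofReal (Real.exp (t * x)) ∂μ < ⊤) :
    Integrable (fun x => Real.exp (t * x)) μ :=
  ⟨by fun_prop, by rwa [hasFiniteIntegral_iff_ofReal (.of_forall fun x => by positivity)]⟩

/-- A law on the half-line with a finite exponential moment is determined by its moments. -/
lemma Measure.ext_of_lintegral_pow_eq {μ ν : Measure ℝ} [IsProbabilityMeasure μ]
    [IsProbabilityMeasure ν] (hμ : ∀ᵐ x ∂μ, 0 ≤ x) (hν : ∀ᵐ x ∂ν, 0 ≤ x) {a : ℝ} (ha : 0 < a)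
    (hexp : ∫⁻ x, ENNReal.ofReal (Real.exp (a * x)) ∂ν < ⊤)
    (h : ∀ n : ℕ, ∫⁻ x, ENNReal.ofReal (x ^ n) ∂μ = ∫⁻ x, ENNReal.ofReal (x ^ n) ∂ν) :
    μ = ν := by
  have heq (t : ℝ) (ht : 0 ≤ t) : ∫⁻ x, ENNReal.ofReal (Real.exp (t * x)) ∂μ =
      ∫⁻ x, ENNReal.ofReal (Real.exp (t * x)) ∂ν := by
    rw [lintegral_ofReal_exp_mul_eq_tsum hμ ht, lintegral_ofReal_exp_mul_eq_tsum hν ht]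
    simp_rw [h]
  have hint (ρ : Measure ℝ) [IsProbabilityMeasure ρ] (hρ : ∀ᵐ x ∂ρ, 0 ≤ x)
      (hρa : ∫⁻ x, ENNReal.ofReal (Real.exp (a * x)) ∂ρ < ⊤) :
      Set.Iio a ⊆ interior (integrableExpSet id ρ) := by
    refine interior_maximal (fun t (ht : t < a) => ?_) isOpen_Iio
    refine (integrable_exp_mul_of_lintegral_lt_top hρa).mono' (by fun_prop) ?_
    filter_upwards [hρ] with x hx
    rw [Real.norm_of_nonneg (by positivity)]
    exact Real.exp_le_exp.2 (mul_le_mul_of_nonneg_right ht.le hx)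
  have hμ' := hint μ hμ (by rwa [heq a ha.le])
  have hν' := hint ν hν hexp
  let U : Set ℂ := {z | z.re < a}
  have hU : IsPreconnected U := (convex_halfSpace_re_lt a).isPreconnected
  have hEq : Set.EqOn (complexMGF id μ) (complexMGF id ν) U := by
    refine AnalyticOnNhd.eqOn_of_preconnected_of_frequently_eq
      (analyticOnNhd_complexMGF.mono fun z hz => hμ' hz)
      (analyticOnNhd_complexMGF.mono fun z hz => hν' hz) hU (z₀ := 0) (by simpa [U] using ha) ?_
    rw [Filter.frequently_iff_seq_forall]
    refine ⟨fun n : ℕ => ((1 / ((n : ℝ) + 1) : ℝ) : ℂ), ?_, fun n => ?_⟩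
    · rw [tendsto_nhdsWithin_iff]
      constructor
      · exact_mod_cast (Complex.continuous_ofReal.tendsto 0).comp
          tendsto_one_div_add_atTop_nhds_zero_nat
      · refine .of_forall fun n => ?_
        have : (1 / ((n : ℝ) + 1) : ℝ) ≠ 0 := by positivity
        simpa only [Set.mem_compl_iff, Set.mem_singleton_iff, Complex.ofReal_eq_zero] using this
    · rw [complexMGF_ofReal, complexMGF_ofReal]
      congr 1
      simp only [mgf, id]
      rw [integral_eq_lintegral_of_nonneg_ae (.of_forall fun x => by positivity) (by fun_prop),
        integral_eq_lintegral_of_nonneg_ae (.of_forall fun x => by positivity) (by fun_prop),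
        heq _ (by positivity)]
  refine Measure.ext_of_charFun (funext fun t => ?_)
  rw [← complexMGF_id_mul_I, ← complexMGF_id_mul_I]
  exact hEq (by simpa [U] using ha)

lemma lintegral_rpow_mul_exp_neg_mul_Ioi {a r : ℝ} (ha : 0 < a) (hr : 0 < r) :
    ∫⁻ x in Set.Ioi (0 : ℝ), ENNReal.ofReal (x ^ (a - 1) * Real.exp (-(r * x))) =
      ENNReal.ofReal ((1 / r) ^ a * Real.Gamma a) := by
  have h := Real.integral_rpow_mul_exp_neg_mul_Ioi ha hr
  have hpos : 0 < (1 / r) ^ a * Real.Gamma a :=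
    mul_pos (by positivity) (Real.Gamma_pos_of_pos ha)
  rw [← h, ofReal_integral_eq_lintegral_ofReal]
  · exact not_imp_comm.1 integral_undef (by rw [h]; exact hpos.ne')
  · filter_upwards [ae_restrict_mem measurableSet_Ioi] with x hx
    have : (0 : ℝ) < x := hx
    positivity

lemma measurable_gammaPDF (a r : ℝ) : Measurable (gammaPDF a r) :=
  (measurable_gammaPDFReal a r).ennreal_ofReal

lemma lintegral_gammaMeasure (a r : ℝ) {g : ℝ → ENNReal} (hg : Measurable g) :
    ∫⁻ x, g x ∂gammaMeasure a r = ∫⁻ x in Set.Ioi (0 : ℝ),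
      ENNReal.ofReal (r ^ a / Real.Gamma a * x ^ (a - 1) * Real.exp (-(r * x))) * g x := by
  rw [gammaMeasure, lintegral_withDensity_eq_lintegral_mul _
    (measurable_gammaPDF a r) hg, ← setLIntegral_eq_of_support_subset
      (s := Set.Ici 0) , setLIntegral_congr Ioi_ae_eq_Ici.symm]
  · refine setLIntegral_congr_fun measurableSet_Ioi fun x hx => ?_
    simp [gammaPDF_of_nonneg (le_of_lt hx)]
  · intro x hx
    by_contra h
    exact hx (by simp [gammaPDF_of_neg (not_le.1 h)])

lemma ae_nonneg_gammaMeasure (a r : ℝ) : ∀ᵐ x ∂gammaMeasure a r, 0 ≤ x := by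
  rw [gammaMeasure, ae_withDensity_iff (measurable_gammaPDF a r)]
  refine .of_forall fun x hx => ?_
  by_contra h
  exact hx (gammaPDF_of_neg (not_le.1 h))

lemma lintegral_pow_gammaMeasure {a r : ℝ} (ha : 0 < a) (hr : 0 < r) (n : ℕ) :
    ∫⁻ x, ENNReal.ofReal (x ^ n) ∂gammaMeasure a r =
      ENNReal.ofReal (r ^ a / Real.Gamma a * ((1 / r) ^ (a + n) * Real.Gamma (a + n))) := by
  have hG := Real.Gamma_pos_of_pos ha
  rw [lintegral_gammaMeasure a r (by fun_prop), ENNReal.ofReal_mul (by positivity),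
    ← lintegral_rpow_mul_exp_neg_mul_Ioi (by positivity) hr, ← lintegral_const_mul _ (by fun_prop)]
  refine setLIntegral_congr_fun measurableSet_Ioi fun x (hx : 0 < x) => ?_
  rw [← ENNReal.ofReal_mul (by positivity), ← ENNReal.ofReal_mul (by positivity)]
  congr 1
  rw [show a + n - 1 = (a - 1) + n by ring, Real.rpow_add hx, Real.rpow_natCast]
  ring

lemma lintegral_pow_succ_gammaMeasure {a r : ℝ} (ha : 0 < a) (hr : 0 < r) (n : ℕ) :
    ∫⁻ x, ENNReal.ofReal (x ^ (n + 1)) ∂gammaMeasure a r =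
      ENNReal.ofReal ((a + n) / r) * ∫⁻ x, ENNReal.ofReal (x ^ n) ∂gammaMeasure a r := by
  rw [lintegral_pow_gammaMeasure ha hr, lintegral_pow_gammaMeasure ha hr,
    ← ENNReal.ofReal_mul (by positivity)]
  congr 1
  push_cast
  rw [← add_assoc, Real.Gamma_add_one (by positivity), Real.rpow_add (by positivity),
    Real.rpow_one]
  ring

lemma lintegral_exp_mul_gammaMeasure_lt_top {a r t : ℝ} (ha : 0 < a) (hr : 0 < r) (ht : t < r) :
    ∫⁻ x, ENNReal.ofReal (Real.exp (t * x)) ∂gammaMeasure a r < ⊤ := by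
  have hG := Real.Gamma_pos_of_pos ha
  rw [lintegral_gammaMeasure a r (by fun_prop)]
  have : ∀ x ∈ Set.Ioi (0 : ℝ),
      ENNReal.ofReal (r ^ a / Real.Gamma a * x ^ (a - 1) * Real.exp (-(r * x))) *
        ENNReal.ofReal (Real.exp (t * x)) =
      ENNReal.ofReal (r ^ a / Real.Gamma a) *
        ENNReal.ofReal (x ^ (a - 1) * Real.exp (-((r - t) * x))) := by
    intro x (hx : 0 < x)
    rw [← ENNReal.ofReal_mul (by positivity), ← ENNReal.ofReal_mul (by positivity)]
    congr 1
    rw [show -((r - t) * x) = -(r * x) + t * x by ring, Real.exp_add]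
    ring
  rw [setLIntegral_congr_fun measurableSet_Ioi this, lintegral_const_mul _ (by fun_prop),
    lintegral_rpow_mul_exp_neg_mul_Ioi ha (sub_pos.2 ht)]
  exact ENNReal.mul_lt_top ENNReal.ofReal_lt_top ENNReal.ofReal_lt_top
section Perpetuity

open scoped NNReal ENNReal

/-- The integrand `exp (-2 x_s - 2 p s)` of the perpetuity along a path `x`. -/
noncomputable def perpetuityIntegrand (p : ℝ) (x : ℝ≥0 → ℝ) (s : ℝ) : ℝ :=
  Real.exp (-2 * x s.toNNReal - 2 * p * s)

/-- The perpetuity `∫_0^∞ exp (-2 x_s - 2 p s) ds` along a path `x`. -/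
noncomputable def perpetuity (p : ℝ) (x : ℝ≥0 → ℝ) : ℝ≥0∞ :=
  ∫⁻ s in Set.Ioi (0 : ℝ), ENNReal.ofReal (perpetuityIntegrand p x s)

lemma perpetuityIntegrand_pos (p : ℝ) (x : ℝ≥0 → ℝ) (s : ℝ) : 0 < perpetuityIntegrand p x s :=
  Real.exp_pos _

lemma continuous_perpetuityIntegrand (p : ℝ) {x : ℝ≥0 → ℝ} (hx : Continuous x) :
    Continuous (perpetuityIntegrand p x) := by
  unfold perpetuityIntegrand
  fun_prop

lemma tendsto_floor_succ_mul_div (t : ℝ≥0) :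
    Filter.Tendsto (fun n : ℕ => (⌊((n : ℝ≥0) + 1) * t⌋₊ : ℝ≥0) / ((n : ℝ≥0) + 1)) Filter.atTop
      (nhds t) := by
  have h := (tendsto_nat_floor_mul_div_atTop (R := ℝ) (a := t) t.2).comp
    ((tendsto_natCast_atTop_atTop (R := ℝ)).comp (Filter.tendsto_add_atTop_nat 1))
  rw [← NNReal.tendsto_coe]
  refine h.congr fun n => ?_
  simp only [Function.comp_apply, NNReal.coe_div, NNReal.coe_natCast, NNReal.coe_add,
    NNReal.coe_one, Nat.cast_add, Nat.cast_one]
  rw [mul_comm]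
  congr 2

/-- On continuous paths, the perpetuity is a measurable functional for the product `σ`-algebra. -/
lemma exists_measurable_eq_perpetuity (p : ℝ) :
    ∃ Φ : (ℝ≥0 → ℝ) → ℝ≥0∞, Measurable Φ ∧ ∀ x, Continuous x → Φ x = perpetuity p x := by
  let F (n : ℕ) (z : (ℝ≥0 → ℝ) × ℝ) : ℝ≥0∞ := ENNReal.ofReal (Real.exp (-2 *
    z.1 ((⌊((n : ℝ≥0) + 1) * z.2.toNNReal⌋₊ : ℝ≥0) / ((n : ℝ≥0) + 1)) - 2 * p * z.2))
  have hF (n : ℕ) : Measurable (F n) := by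
    have h1 : Measurable fun z : (ℝ≥0 → ℝ) × ℕ => z.1 ((z.2 : ℝ≥0) / ((n : ℝ≥0) + 1)) :=
      measurable_from_prod_countable_left fun k => measurable_pi_apply ((k : ℝ≥0) / ((n : ℝ≥0) + 1))
    have h2 : Measurable fun z : (ℝ≥0 → ℝ) × ℝ => (z.1, ⌊((n : ℝ≥0) + 1) * z.2.toNNReal⌋₊) :=
      measurable_fst.prodMk (by fun_prop)
    have h3 := h1.comp h2
    simp only [Function.comp_def] at h3
    fun_prop
  refine ⟨fun x => ∫⁻ s in Set.Ioi (0 : ℝ), Filter.liminf (fun n => F n (x, s)) Filter.atTop,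
    Measurable.lintegral_prod_right' (f := fun z => Filter.liminf (fun n => F n z) Filter.atTop)
      (Measurable.liminf hF), fun x hx => ?_⟩
  refine lintegral_congr fun s => Filter.Tendsto.liminf_eq ?_
  refine ENNReal.tendsto_ofReal ((Real.continuous_exp.tendsto _).comp ?_)
  exact (((hx.tendsto _).comp (tendsto_floor_succ_mul_div _)).const_mul _).sub_const _

lemma lintegral_Ioi_eq_mul_perpetuity_shift (p : ℝ) (x : ℝ≥0 → ℝ) (t : ℝ≥0) :
    ∫⁻ s in Set.Ioi (t : ℝ), ENNReal.ofReal (perpetuityIntegrand p x s) =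
      ENNReal.ofReal (perpetuityIntegrand p x t) * perpetuity p (fun r => x (t + r) - x t) := by
  rw [perpetuity, ← lintegral_const_mul' _ _ ENNReal.ofReal_ne_top,
    ← lintegral_indicator measurableSet_Ioi, ← lintegral_indicator measurableSet_Ioi,
    ← lintegral_add_left_eq_self _ (t : ℝ)]
  refine lintegral_congr fun r => ?_
  by_cases hr : 0 < r
  · rw [Set.indicator_of_mem (by simpa using hr), Set.indicator_of_mem (by simpa using hr),
      ← ENNReal.ofReal_mul (perpetuityIntegrand_pos _ _ _).le, perpetuityIntegrand,
      perpetuityIntegrand, perpetuityIntegrand, ← Real.exp_add,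
      Real.toNNReal_add t.coe_nonneg hr.le, Real.toNNReal_coe]
    congr 2
    ring
  · rw [Set.indicator_of_notMem (by simpa using hr), Set.indicator_of_notMem (by simpa using hr)]

lemma setLIntegral_ofReal_pos {f : ℝ → ℝ} (hf : ∀ s, 0 < f s) (hc : Continuous f) (t : ℝ) :
    0 < ∫⁻ s in Set.Ioi t, ENNReal.ofReal (f s) := by
  rw [setLIntegral_pos_iff hc.measurable.ennreal_ofReal]
  have : Function.support (fun s => ENNReal.ofReal (f s)) = Set.univ :=
    Set.eq_univ_of_forall fun s => by simpa using hf s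
  simp [this]

lemma perpetuity_pos (p : ℝ) {x : ℝ≥0 → ℝ} (hx : Continuous x) : 0 < perpetuity p x :=
  setLIntegral_ofReal_pos (perpetuityIntegrand_pos p x) (continuous_perpetuityIntegrand p hx) 0

/-- Fundamental theorem of calculus for a negative power of the tail integral. -/
lemma lintegral_Ioi_rpow_neg_eq_add {f : ℝ → ℝ} (hf : ∀ s, 0 < f s) (hc : Continuous f)
    (hfin : ∫⁻ s in Set.Ioi (0 : ℝ), ENNReal.ofReal (f s) < ⊤) {q : ℝ} (hq : 0 < q) {t : ℝ}
    (ht : 0 ≤ t) :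
    (∫⁻ s in Set.Ioi t, ENNReal.ofReal (f s)) ^ (-q) =
      (∫⁻ s in Set.Ioi (0 : ℝ), ENNReal.ofReal (f s)) ^ (-q) +
        ∫⁻ s in Set.Ioc 0 t, ENNReal.ofReal q * (ENNReal.ofReal (f s) *
          (∫⁻ r in Set.Ioi s, ENNReal.ofReal (f r)) ^ (-(q + 1))) := by
  have hint : IntegrableOn f (Set.Ioi 0) :=
    ⟨hc.aestronglyMeasurable, by
      rwa [hasFiniteIntegral_iff_ofReal (.of_forall fun x => (hf x).le)]⟩
  let J (s : ℝ) : ℝ := (∫ r in Set.Ioi (0 : ℝ), f r) - ∫ r in (0 : ℝ)..s, f r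
  have hJeq {s : ℝ} (hs : 0 ≤ s) : ∫⁻ r in Set.Ioi s, ENNReal.ofReal (f r) =
      ENNReal.ofReal (J s) := by
    rw [← ofReal_integral_eq_lintegral_ofReal (hint.mono_set (Set.Ioi_subset_Ioi hs))
      (.of_forall fun x => (hf x).le)]
    congr 1
    simp only [J]
    rw [← intervalIntegral.integral_Ioi_sub_Ioi hint hs]
    ring
  have hJpos {s : ℝ} (hs : 0 ≤ s) : 0 < J s := by
    rw [← ENNReal.ofReal_pos, ← hJeq hs]
    exact setLIntegral_ofReal_pos hf hc s
  have hJd (s : ℝ) : HasDerivAt J (-f s) s :=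
    (hc.integral_hasStrictDerivAt 0 s).hasDerivAt.const_sub _
  have hJc : Continuous J := continuous_iff_continuousAt.2 fun s => (hJd s).continuousAt
  let G (s : ℝ) : ℝ := q * (f s * J s ^ (-(q + 1)))
  have hGd (s : ℝ) (hs : 0 ≤ s) : HasDerivAt (fun s => J s ^ (-q)) (G s) s := by
    convert (hJd s).rpow_const (p := -q) (Or.inl (hJpos hs).ne') using 1
    simp only [G]
    rw [show -q - 1 = -(q + 1) by ring]
    ring
  have hGc : ContinuousOn G (Set.Icc 0 t) := by
    refine continuousOn_const.mul (hc.continuousOn.mul ?_)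
    exact hJc.continuousOn.rpow_const fun s hs => Or.inl (hJpos hs.1).ne'
  have hGi : IntervalIntegrable G volume 0 t := by
    apply ContinuousOn.intervalIntegrable
    rwa [Set.uIcc_of_le ht]
  have hftc := intervalIntegral.integral_eq_sub_of_hasDerivAt
    (fun s hs => hGd s (by rw [Set.uIcc_of_le ht] at hs; exact hs.1)) hGi
  rw [intervalIntegral.integral_of_le ht] at hftc
  have hGnn : ∀ s ∈ Set.Ioc 0 t, 0 ≤ G s := fun s hs => by
    have h1 := hJpos hs.1.le
    have h2 := hf s
    positivity
  rw [hJeq ht, hJeq le_rfl, ENNReal.ofReal_rpow_of_pos (hJpos ht),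
    ENNReal.ofReal_rpow_of_pos (hJpos le_rfl), ← sub_add_cancel (J t ^ (-q)) (J 0 ^ (-q)),
    ← hftc, add_comm, ENNReal.ofReal_add (Real.rpow_nonneg (hJpos le_rfl).le _)
      (setIntegral_nonneg measurableSet_Ioc hGnn),
    ofReal_integral_eq_lintegral_ofReal ((intervalIntegrable_iff_integrableOn_Ioc_of_le ht).1 hGi)
      ((ae_restrict_iff' measurableSet_Ioc).2 (.of_forall hGnn))]
  congr 1
  refine setLIntegral_congr_fun measurableSet_Ioc fun s hs => ?_
  simp only [G]
  rw [hJeq hs.1.le, ENNReal.ofReal_rpow_of_pos (hJpos hs.1.le), ENNReal.ofReal_mul hq.le,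
    ENNReal.ofReal_mul (hf s).le]

/-- Jensen's inequality for a negative power of an integral over the unit interval. -/
lemma lintegral_Ioi_rpow_neg_le {f : ℝ → ℝ} (hf : ∀ s, 0 < f s) (hc : Continuous f) {q : ℝ}
    (hq : 0 ≤ q) :
    (∫⁻ s in Set.Ioi (0 : ℝ), ENNReal.ofReal (f s)) ^ (-q) ≤
      ∫⁻ s in Set.Ioc (0 : ℝ) 1, ENNReal.ofReal (f s ^ (-q)) := by
  let P : Measure ℝ := volume.restrict (Set.Ioc 0 1)
  have : IsProbabilityMeasure P := ⟨by simp [P]⟩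
  have hi {g : ℝ → ℝ} (hg : Continuous g) : Integrable g P :=
    (hg.integrableOn_Icc (a := 0) (b := 1)).mono_set Set.Ioc_subset_Icc_self
  have hlog : Continuous fun s => Real.log (f s) := hc.log fun s => (hf s).ne'
  have hexp {g : ℝ → ℝ} (hg : Continuous g) :
      Real.exp (∫ s, g s ∂P) ≤ ∫ s, Real.exp (g s) ∂P :=
    convexOn_exp.map_integral_le Real.continuous_exp.continuousOn isClosed_univ (by simp)
      (hi hg) (hi (Real.continuous_exp.comp hg))
  have h1 := hexp hlog
  have h2 := hexp (hlog.const_mul (-q))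
  have e (s : ℝ) : Real.exp (-q * Real.log (f s)) = f s ^ (-q) := by
    rw [Real.rpow_def_of_pos (hf s), mul_comm]
  simp_rw [Real.exp_log (hf _)] at h1
  simp_rw [e] at h2
  rw [integral_const_mul] at h2
  have hc' : Continuous fun s => f s ^ (-q) := hc.rpow_const fun s => Or.inl (hf s).ne'
  have hpos := (Real.exp_pos _).trans_le h1
  calc (∫⁻ s in Set.Ioi (0 : ℝ), ENNReal.ofReal (f s)) ^ (-q)
      ≤ (∫⁻ s, ENNReal.ofReal (f s) ∂P) ^ (-q) := by
        rw [ENNReal.rpow_neg, ENNReal.rpow_neg, ENNReal.inv_le_inv]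
        exact ENNReal.rpow_le_rpow (lintegral_mono_set Set.Ioc_subset_Ioi_self) hq
    _ = ENNReal.ofReal ((∫ s, f s ∂P) ^ (-q)) := by
        rw [← ofReal_integral_eq_lintegral_ofReal (hi hc) (.of_forall fun s => (hf s).le),
          ENNReal.ofReal_rpow_of_pos hpos]
    _ ≤ ENNReal.ofReal (Real.exp (-q * ∫ s, Real.log (f s) ∂P)) := by
        refine ENNReal.ofReal_le_ofReal ?_
        rw [mul_comm, Real.exp_mul]
        exact Real.rpow_le_rpow_of_nonpos (Real.exp_pos _) h1 (by linarith)
    _ ≤ ENNReal.ofReal (∫ s, f s ^ (-q) ∂P) := ENNReal.ofReal_le_ofReal h2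
    _ = _ := ofReal_integral_eq_lintegral_ofReal (hi hc')
        (.of_forall fun s => Real.rpow_nonneg (hf s).le _)
section Brownian

variable {Ω : Type*} [MeasurableSpace Ω] {P : Measure Ω} {W : ℝ≥0 → Ω → ℝ}

lemma lintegral_exp_mul_of_map_eq_gaussianReal {X : Ω → ℝ} {v : ℝ≥0} (hX : Measurable X)
    (h : P.map X = gaussianReal 0 v) (c : ℝ) :
    ∫⁻ ω, ENNReal.ofReal (Real.exp (c * X ω)) ∂P = ENNReal.ofReal (Real.exp (v * c ^ 2 / 2)) := by
  have hi : Integrable (fun ω => Real.exp (c * X ω)) P := by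
    refine (integrable_map_measure (μ := P) (f := X) (g := fun x => Real.exp (c * x))
      (by fun_prop) hX.aemeasurable).1 ?_
    rw [h]
    exact integrable_exp_mul_gaussianReal c
  have hmgf := mgf_gaussianReal h c
  rw [mgf, zero_mul, zero_add] at hmgf
  rw [← hmgf, ofReal_integral_eq_lintegral_ofReal hi (.of_forall fun ω => (Real.exp_pos _).le)]

lemma lintegral_perpetuityIntegrand_rpow (hW : IsPreBrownianReal W P) (hm : ∀ t, Measurable (W t))
    (p b : ℝ) {s : ℝ} (hs : 0 ≤ s) :
    ∫⁻ ω, ENNReal.ofReal (perpetuityIntegrand p (W · ω) s ^ b) ∂P =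
      ENNReal.ofReal (Real.exp ((2 * b ^ 2 - 2 * p * b) * s)) := by
  have h (ω : Ω) : ENNReal.ofReal (perpetuityIntegrand p (W · ω) s ^ b) =
      ENNReal.ofReal (Real.exp (-(2 * p * b * s))) *
        ENNReal.ofReal (Real.exp (-(2 * b) * W s.toNNReal ω)) := by
    rw [← ENNReal.ofReal_mul (Real.exp_pos _).le, perpetuityIntegrand, ← Real.exp_mul,
      ← Real.exp_add]
    congr 2
    ring
  simp_rw [h]
  rw [lintegral_const_mul _ (by have := hm s.toNNReal; fun_prop),
    lintegral_exp_mul_of_map_eq_gaussianReal (hm _) (hW.hasLaw_eval _).map_eq,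
    ← ENNReal.ofReal_mul (Real.exp_pos _).le, ← Real.exp_add, Real.coe_toNNReal s hs]
  congr 2
  ring

lemma measurable_perpetuityIntegrand (hm : ∀ t, Measurable (W t)) (hc : ∀ ω, Continuous (W · ω))
    (p : ℝ) : Measurable fun z : ℝ × Ω => perpetuityIntegrand p (W · z.2) z.1 := by
  refine measurable_uncurry_of_continuous_of_measurable
    (u := fun s ω => perpetuityIntegrand p (W · ω) s)
    (fun ω => continuous_perpetuityIntegrand p (hc ω)) fun s => ?_
  unfold perpetuityIntegrand
  have := hm s.toNNReal
  fun_prop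

lemma measurable_lintegral_Ioi_perpetuityIntegrand (hm : ∀ t, Measurable (W t))
    (hc : ∀ ω, Continuous (W · ω)) (p : ℝ) :
    Measurable fun z : ℝ × Ω => ∫⁻ s in Set.Ioi z.1,
      ENNReal.ofReal (perpetuityIntegrand p (W · z.2) s) := by
  simp_rw [← lintegral_indicator measurableSet_Ioi]
  refine Measurable.lintegral_prod_right' (f := fun y : (ℝ × Ω) × ℝ =>
    (Set.Ioi y.1.1).indicator (fun s => ENNReal.ofReal (perpetuityIntegrand p (W · y.1.2) s)) y.2) ?_
  have h1 : Measurable fun y : (ℝ × Ω) × ℝ =>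
      ENNReal.ofReal (perpetuityIntegrand p (W · y.1.2) y.2) :=
    ((measurable_perpetuityIntegrand hm hc p).comp
      (measurable_snd.prodMk (measurable_snd.comp measurable_fst))).ennreal_ofReal
  exact h1.indicator (s := {y : (ℝ × Ω) × ℝ | y.1.1 < y.2})
    (measurableSet_lt (by fun_prop) (by fun_prop))

lemma measurable_perpetuity (hm : ∀ t, Measurable (W t)) (hc : ∀ ω, Continuous (W · ω))
    (p : ℝ) : Measurable fun ω => perpetuity p (W · ω) :=
  (measurable_lintegral_Ioi_perpetuityIntegrand hm hc p).comp (measurable_const.prodMk measurable_id)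

/-- Expectation of a product of powers of the integrand and of the tail integral, by the weak
Markov property. -/
lemma lintegral_perpetuityIntegrand_mul_tail (hW : IsPreBrownianReal W P)
    (hm : ∀ t, Measurable (W t)) (hc : ∀ ω, Continuous (W · ω)) (p a q : ℝ) {t : ℝ}
    (ht : 0 ≤ t) :
    ∫⁻ ω, ENNReal.ofReal (perpetuityIntegrand p (W · ω) t) ^ a *
        (∫⁻ s in Set.Ioi t, ENNReal.ofReal (perpetuityIntegrand p (W · ω) s)) ^ (-q) ∂P =
      ENNReal.ofReal (Real.exp ((2 * (a - q) ^ 2 - 2 * p * (a - q)) * t)) *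
        ∫⁻ ω, perpetuity p (W · ω) ^ (-q) ∂P := by
  have := hW.isGaussianProcess.isProbabilityMeasure
  obtain ⟨Φ, hΦ, hΦeq⟩ := exists_measurable_eq_perpetuity p
  lift t to ℝ≥0 using ht
  let V (r : ℝ≥0) (ω : Ω) : ℝ := W (t + r) ω - W t ω
  have hVm : Measurable fun ω r => V r ω := measurable_pi_lambda _ fun r => (hm _).sub (hm _)
  have hWm : Measurable fun ω r => W r ω := measurable_pi_lambda _ hm
  have hVc (ω : Ω) : Continuous (V · ω) :=
    ((hc ω).comp (continuous_const.add continuous_id)).sub continuous_const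
  have hlaw : P.map (fun ω r => V r ω) = P.map (fun ω r => W r ω) := by
    rw [map_eq_iff_forall_finset_map_restrict_eq hVm.aemeasurable hWm.aemeasurable]
    intro I
    rw [((hW.shift t).hasLaw I).map_eq, (hW.hasLaw I).map_eq]
  have hind : IndepFun (fun ω => Φ (V · ω) ^ (-q))
      (fun ω => ENNReal.ofReal (perpetuityIntegrand p (W · ω) t ^ (a - q))) P := by
    refine (hW.indepFun_shift t).comp (φ := fun x => Φ x ^ (-q))
      (ψ := fun y : Set.Iic t → ℝ => ENNReal.ofReal
        (Real.exp (-2 * y ⟨t, Set.mem_Iic.2 le_rfl⟩ - 2 * p * t) ^ (a - q))) (hΦ.pow_const _)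
        (by fun_prop) |>.congr (.of_forall fun ω => rfl) (.of_forall fun ω => ?_)
    simp [perpetuityIntegrand]
  have hpt (ω : Ω) : ENNReal.ofReal (perpetuityIntegrand p (W · ω) t) ^ a *
        (∫⁻ s in Set.Ioi (t : ℝ), ENNReal.ofReal (perpetuityIntegrand p (W · ω) s)) ^ (-q) =
      Φ (V · ω) ^ (-q) * ENNReal.ofReal (perpetuityIntegrand p (W · ω) t ^ (a - q)) := by
    have hpos := perpetuityIntegrand_pos p (W · ω) t
    rw [lintegral_Ioi_eq_mul_perpetuity_shift, ENNReal.mul_rpow_of_ne_zero (by simpa using hpos)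
      (perpetuity_pos p (hVc ω)).ne', ← mul_assoc, ← ENNReal.rpow_add _ _ (by simpa using hpos)
      ENNReal.ofReal_ne_top, ENNReal.ofReal_rpow_of_pos hpos, mul_comm, ← sub_eq_add_neg,
      hΦeq _ (hVc ω)]
  have hmeas : Measurable fun ω => ENNReal.ofReal (perpetuityIntegrand p (W · ω) t ^ (a - q)) :=
    (((measurable_perpetuityIntegrand hm hc p).comp
      (measurable_const.prodMk measurable_id)).pow_const _).ennreal_ofReal
  have hmul := lintegral_mul_eq_lintegral_mul_lintegral_of_indepFun
    ((hΦ.comp hVm).pow_const (-q)) hmeas hind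
  simp only [Pi.mul_apply, Function.comp_apply] at hmul
  simp_rw [hpt]
  rw [hmul, lintegral_perpetuityIntegrand_rpow hW hm p (a - q) t.coe_nonneg, mul_comm]
  congr 1
  rw [← lintegral_map (hΦ.pow_const (-q)) hVm, hlaw, lintegral_map (hΦ.pow_const (-q)) hWm]
  exact lintegral_congr fun ω => by rw [hΦeq _ (hc ω)]

lemma lintegral_perpetuity_rpow_neg_lt_top (hW : IsPreBrownianReal W P)
    (hm : ∀ t, Measurable (W t)) (hc : ∀ ω, Continuous (W · ω)) (p : ℝ) {q : ℝ} (hq : 0 ≤ q) :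
    ∫⁻ ω, perpetuity p (W · ω) ^ (-q) ∂P < ⊤ := by
  have := hW.isGaussianProcess.isProbabilityMeasure
  calc ∫⁻ ω, perpetuity p (W · ω) ^ (-q) ∂P
      ≤ ∫⁻ ω, (∫⁻ s in Set.Ioc (0 : ℝ) 1,
          ENNReal.ofReal (perpetuityIntegrand p (W · ω) s ^ (-q))) ∂P :=
        lintegral_mono fun ω => lintegral_Ioi_rpow_neg_le (perpetuityIntegrand_pos p _)
          (continuous_perpetuityIntegrand p (hc ω)) hq
    _ = ∫⁻ s in Set.Ioc (0 : ℝ) 1,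
          (∫⁻ ω, ENNReal.ofReal (perpetuityIntegrand p (W · ω) s ^ (-q)) ∂P) :=
        lintegral_lintegral_swap (((measurable_perpetuityIntegrand hm hc p).comp
          measurable_swap).pow_const _).ennreal_ofReal.aemeasurable
    _ = ∫⁻ s in Set.Ioc (0 : ℝ) 1,
          ENNReal.ofReal (Real.exp ((2 * (-q) ^ 2 - 2 * p * (-q)) * s)) :=
        setLIntegral_congr_fun measurableSet_Ioc fun s hs =>
          lintegral_perpetuityIntegrand_rpow hW hm p (-q) hs.1.le
    _ < ⊤ := by
        have hcont : Continuous fun s => Real.exp ((2 * (-q) ^ 2 - 2 * p * (-q)) * s) := by fun_prop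
        have hi : IntegrableOn (fun s => Real.exp ((2 * (-q) ^ 2 - 2 * p * (-q)) * s))
          (Set.Ioc 0 1) := (hcont.integrableOn_Icc (a := 0) (b := 1)).mono_set
            Set.Ioc_subset_Icc_self
        exact hi.lintegral_lt_top

/-- The perpetuity is almost surely finite. -/
lemma ae_perpetuity_lt_top (hW : IsPreBrownianReal W P)
    (hm : ∀ t, Measurable (W t)) (hc : ∀ ω, Continuous (W · ω)) {p : ℝ} (hp : 0 < p) :
    ∀ᵐ ω ∂P, perpetuity p (W · ω) < ⊤ := by
  have := hW.isGaussianProcess.isProbabilityMeasure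
  let M (n : ℕ) (ω : Ω) : ℝ := perpetuityIntegrand p (W · ω) n
  let Z (n : ℕ) (ω : Ω) : ℝ≥0∞ := ∫⁻ s in Set.Ioc (n : ℝ) (n + 1),
    ENNReal.ofReal (perpetuityIntegrand p (W · ω) s / M n ω)
  have hMpos (n : ℕ) (ω : Ω) : 0 < M n ω := perpetuityIntegrand_pos _ _ _
  have hMm (n : ℕ) : Measurable (M n) :=
    (measurable_perpetuityIntegrand hm hc p).comp (measurable_const.prodMk measurable_id)
  have hratio (n : ℕ) : Measurable fun z : Ω × ℝ =>
      ENNReal.ofReal (perpetuityIntegrand p (W · z.1) z.2 / M n z.1) :=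
    (((measurable_perpetuityIntegrand hm hc p).comp measurable_swap).div
      ((hMm n).comp measurable_fst)).ennreal_ofReal
  have hZm (n : ℕ) : Measurable (Z n) := (hratio n).lintegral_prod_right'
  have hsum {c : ℝ} (hc : 0 < c) : ∑' n : ℕ, ENNReal.ofReal (Real.exp (-c * n)) < ⊤ := by
    have hs : Summable fun n : ℕ => Real.exp (-c * n) := by
      simp_rw [mul_comm (-c)]
      exact Real.summable_exp_nat_mul_iff.2 (by linarith)
    rw [← ENNReal.ofReal_tsum_of_nonneg (fun n => (Real.exp_pos _).le) hs]
    exact ENNReal.ofReal_lt_top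
  have hZ (n : ℕ) : ∫⁻ ω, Z n ω ∂P ≤ ENNReal.ofReal (Real.exp 2) := by
    have hswap : ∫⁻ ω, Z n ω ∂P = ∫⁻ s in Set.Ioc (n : ℝ) (n + 1),
        ∫⁻ ω, ENNReal.ofReal (perpetuityIntegrand p (W · ω) s / M n ω) ∂P :=
      lintegral_lintegral_swap (hratio n).aemeasurable
    rw [hswap]
    calc _ ≤ ∫⁻ s in Set.Ioc (n : ℝ) (n + 1), ENNReal.ofReal (Real.exp 2) := by
          refine setLIntegral_mono' measurableSet_Ioc fun s hs => ?_
          have hs0 : 0 ≤ s := (Nat.cast_nonneg n).trans hs.1.le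
          have hb (ω : Ω) : ENNReal.ofReal (perpetuityIntegrand p (W · ω) s / M n ω) ≤
              ENNReal.ofReal (Real.exp (-2 * (W s.toNNReal - W n) ω)) := by
            refine ENNReal.ofReal_le_ofReal ?_
            simp only [M, perpetuityIntegrand]
            rw [← Real.exp_sub, Real.toNNReal_natCast, Real.exp_le_exp, Pi.sub_apply]
            nlinarith [hs.1]
          refine (lintegral_mono hb).trans ?_
          rw [lintegral_exp_mul_of_map_eq_gaussianReal ((hm _).sub (hm _))
            (hW.hasLaw_sub _ _).map_eq]
          refine ENNReal.ofReal_le_ofReal (Real.exp_le_exp.2 ?_)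
          have : ((nndist (s.toNNReal : ℝ) ((n : ℝ≥0) : ℝ) : ℝ≥0) : ℝ) ≤ 1 := by
            rw [coe_nndist, Real.dist_eq, Real.coe_toNNReal s hs0, NNReal.coe_natCast, abs_le]
            constructor <;> linarith [hs.1, hs.2]
          change ((nndist (s.toNNReal : ℝ) ((n : ℝ≥0) : ℝ) : ℝ≥0) : ℝ) * _ / 2 ≤ _
          linarith
      _ = ENNReal.ofReal (Real.exp 2) := by simp
  have h1 : ∀ᵐ ω ∂P, ∑' n : ℕ, ENNReal.ofReal ((M n ω * Real.exp (p / 2 * n)) ^ (p / 2)) < ⊤ := by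
    refine ae_lt_top (Measurable.tsum fun n =>
      (((hMm n).mul_const _).pow_const _).ennreal_ofReal) ?_
    rw [lintegral_tsum fun n => (((hMm n).mul_const _).pow_const _).ennreal_ofReal.aemeasurable]
    have h (n : ℕ) : ∫⁻ ω, ENNReal.ofReal ((M n ω * Real.exp (p / 2 * n)) ^ (p / 2)) ∂P =
        ENNReal.ofReal (Real.exp (-(p ^ 2 / 4) * n)) := by
      have h' (ω : Ω) : ENNReal.ofReal ((M n ω * Real.exp (p / 2 * n)) ^ (p / 2)) =
          ENNReal.ofReal (M n ω ^ (p / 2)) * ENNReal.ofReal (Real.exp (p / 2 * n * (p / 2))) := by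
        rw [Real.mul_rpow (hMpos n ω).le (Real.exp_pos _).le, ← Real.exp_mul,
          ENNReal.ofReal_mul (Real.rpow_nonneg (hMpos n ω).le _)]
      simp_rw [h']
      rw [lintegral_mul_const _ ((hMm n).pow_const _).ennreal_ofReal,
        lintegral_perpetuityIntegrand_rpow hW hm p (p / 2) (Nat.cast_nonneg n),
        ← ENNReal.ofReal_mul (Real.exp_pos _).le, ← Real.exp_add]
      congr 2
      ring
    simp_rw [h]
    exact (hsum (by positivity)).ne
  have h2 : ∀ᵐ ω ∂P, ∑' n : ℕ, ENNReal.ofReal (Real.exp (-(p / 2) * n)) * Z n ω < ⊤ := by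
    refine ae_lt_top (Measurable.tsum fun n => (hZm n).const_mul _) ?_
    rw [lintegral_tsum fun n => ((hZm n).const_mul _).aemeasurable]
    refine ne_top_of_le_ne_top (ENNReal.mul_ne_top (hsum (half_pos hp)).ne
      (ENNReal.ofReal_ne_top (r := Real.exp 2))) ?_
    rw [← ENNReal.tsum_mul_right]
    refine ENNReal.tsum_le_tsum fun n => ?_
    rw [lintegral_const_mul _ (hZm n)]
    gcongr
    exact hZ n
  filter_upwards [h1, h2] with ω hω1 hω2
  have hU : Set.Ioi (0 : ℝ) = ⋃ n : ℕ, Set.Ioc (n : ℝ) (n + 1) := by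
    have := iUnion_Ioc_map_succ_eq_Ioi (α := ℕ) (f := fun n => (n : ℝ)) (fun a => by simp)
      (not_bddAbove_iff.2 fun x => by
        obtain ⟨n, hn⟩ := exists_nat_gt x
        exact ⟨n, ⟨n, rfl⟩, hn⟩)
    simpa using this.symm
  rw [perpetuity, hU]
  refine (lintegral_iUnion_le _ _).trans_lt ?_
  refine lt_of_le_of_lt ?_ (ENNReal.mul_lt_top
    (ENNReal.rpow_lt_top_of_nonneg (inv_nonneg.2 (half_pos hp).le) hω1.ne) hω2)
  rw [← ENNReal.tsum_mul_left]
  refine ENNReal.tsum_le_tsum fun n => ?_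
  have hle : ENNReal.ofReal (M n ω * Real.exp (p / 2 * n)) ≤
      (∑' n : ℕ, ENNReal.ofReal ((M n ω * Real.exp (p / 2 * n)) ^ (p / 2))) ^ (p / 2)⁻¹ := by
    rw [ENNReal.le_rpow_inv_iff (half_pos hp),
      ENNReal.ofReal_rpow_of_pos (mul_pos (hMpos n ω) (Real.exp_pos _))]
    exact ENNReal.le_tsum n
  calc ∫⁻ s in Set.Ioc (n : ℝ) (n + 1), ENNReal.ofReal (perpetuityIntegrand p (W · ω) s)
      = ENNReal.ofReal (M n ω) * Z n ω := by
        simp only [Z]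
        rw [← lintegral_const_mul' _ _ ENNReal.ofReal_ne_top]
        refine lintegral_congr fun s => ?_
        rw [← ENNReal.ofReal_mul (hMpos n ω).le, mul_div_cancel₀ _ (hMpos n ω).ne']
    _ = ENNReal.ofReal (M n ω * Real.exp (p / 2 * n)) *
          (ENNReal.ofReal (Real.exp (-(p / 2) * n)) * Z n ω) := by
        rw [← mul_assoc, ← ENNReal.ofReal_mul (mul_pos (hMpos n ω) (Real.exp_pos _)).le, mul_assoc,
          ← Real.exp_add]
        simp
    _ ≤ _ := by gcongr

lemma lintegral_perpetuity_rpow_neg_add_one (hW : IsPreBrownianReal W P)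
    (hm : ∀ t, Measurable (W t)) (hc : ∀ ω, Continuous (W · ω)) {p : ℝ} (hp : 0 < p) {q : ℝ}
    (hq : 0 < q) :
    ∫⁻ ω, perpetuity p (W · ω) ^ (-(q + 1)) ∂P =
      ENNReal.ofReal (2 * (p + q)) * ∫⁻ ω, perpetuity p (W · ω) ^ (-q) ∂P := by
  have := hW.isGaussianProcess.isProbabilityMeasure
  have hfin := lintegral_perpetuity_rpow_neg_lt_top hW hm hc p hq.le
  have hfin' := lintegral_perpetuity_rpow_neg_lt_top hW hm hc p (q := q + 1) (by linarith)
  let c : ℝ := 2 * q * (p + q)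
  have hcpos : 0 < c := by positivity
  let H (ω : Ω) (s : ℝ) : ℝ≥0∞ :=
    ENNReal.ofReal q * (ENNReal.ofReal (perpetuityIntegrand p (W · ω) s) *
      (∫⁻ r in Set.Ioi s, ENNReal.ofReal (perpetuityIntegrand p (W · ω) r)) ^ (-(q + 1)))
  have hHm : Measurable (Function.uncurry H) :=
    (((measurable_perpetuityIntegrand hm hc p).comp measurable_swap).ennreal_ofReal.mul
      (((measurable_lintegral_Ioi_perpetuityIntegrand hm hc p).comp
        measurable_swap).pow_const _)).const_mul _
  have hsplit : ∫⁻ ω, (∫⁻ s in Set.Ioi (1 : ℝ),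
        ENNReal.ofReal (perpetuityIntegrand p (W · ω) s)) ^ (-q) ∂P =
      ∫⁻ ω, perpetuity p (W · ω) ^ (-q) ∂P + ∫⁻ ω, (∫⁻ s in Set.Ioc (0 : ℝ) 1, H ω s) ∂P := by
    rw [← lintegral_add_left ((measurable_perpetuity hm hc p).pow_const _)]
    refine lintegral_congr_ae ?_
    filter_upwards [ae_perpetuity_lt_top hW hm hc hp] with ω hω
    exact lintegral_Ioi_rpow_neg_eq_add (perpetuityIntegrand_pos p _)
      (continuous_perpetuityIntegrand p (hc ω)) hω hq zero_le_one
  have hleft := lintegral_perpetuityIntegrand_mul_tail hW hm hc p 0 q zero_le_one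
  simp only [ENNReal.rpow_zero, one_mul] at hleft
  have hright : ∫⁻ ω, (∫⁻ s in Set.Ioc (0 : ℝ) 1, H ω s) ∂P =
      ENNReal.ofReal (q * ((Real.exp c - 1) / c)) *
        ∫⁻ ω, perpetuity p (W · ω) ^ (-(q + 1)) ∂P := by
    rw [lintegral_lintegral_swap hHm.aemeasurable]
    have h : ∀ s ∈ Set.Ioc (0 : ℝ) 1, ∫⁻ ω, H ω s ∂P =
        ENNReal.ofReal (q * Real.exp (c * s)) *
          ∫⁻ ω, perpetuity p (W · ω) ^ (-(q + 1)) ∂P := by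
      intro s hs
      have h1 := lintegral_perpetuityIntegrand_mul_tail hW hm hc p 1 (q + 1) hs.1.le
      simp only [ENNReal.rpow_one] at h1
      simp only [H]
      rw [lintegral_const_mul' _ _ ENNReal.ofReal_ne_top, h1, ← mul_assoc,
        ← ENNReal.ofReal_mul hq.le]
      congr 4
      simp only [c]
      ring
    rw [setLIntegral_congr_fun measurableSet_Ioc h, lintegral_mul_const' _ _ hfin'.ne]
    congr 1
    have hcont : Continuous fun s => q * Real.exp (c * s) := by fun_prop
    rw [← ofReal_integral_eq_lintegral_ofReal
      ((hcont.integrableOn_Icc (a := 0) (b := 1)).mono_set Set.Ioc_subset_Icc_self)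
      (.of_forall fun s => by positivity), ← intervalIntegral.integral_of_le zero_le_one,
      intervalIntegral.integral_const_mul, intervalIntegral.integral_comp_mul_left _ hcpos.ne',
      integral_exp]
    congr 2
    simp [div_eq_inv_mul]
  rw [hleft, hright] at hsplit
  obtain ⟨m, hm0, hmeq⟩ : ∃ m : ℝ, 0 ≤ m ∧
      ∫⁻ ω, perpetuity p (W · ω) ^ (-q) ∂P = ENNReal.ofReal m :=
    ⟨_, ENNReal.toReal_nonneg, (ENNReal.ofReal_toReal hfin.ne).symm⟩
  obtain ⟨m', hm0', hmeq'⟩ : ∃ m : ℝ, 0 ≤ m ∧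
      ∫⁻ ω, perpetuity p (W · ω) ^ (-(q + 1)) ∂P = ENNReal.ofReal m :=
    ⟨_, ENNReal.toReal_nonneg, (ENNReal.ofReal_toReal hfin'.ne).symm⟩
  have hexp : 0 < Real.exp c - 1 := by linarith [Real.add_one_lt_exp hcpos.ne']
  have hcq : (2 * (0 - q) ^ 2 - 2 * p * (0 - q)) * 1 = c := by
    simp only [c]
    ring
  have hk : 0 ≤ q * ((Real.exp c - 1) / c) := by positivity
  rw [hmeq, hmeq', hcq, ← ENNReal.ofReal_mul (Real.exp_pos _).le, ← ENNReal.ofReal_mul hk,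
    ← ENNReal.ofReal_add hm0 (mul_nonneg hk hm0'),
    ENNReal.ofReal_eq_ofReal_iff (by positivity) (by positivity)] at hsplit
  rw [hmeq, hmeq', ← ENNReal.ofReal_mul (by positivity)]
  congr 1
  have h3 : (Real.exp c - 1) * m = (Real.exp c - 1) * (q * m' / c) := by
    linear_combination hsplit
  have h4 := mul_left_cancel₀ hexp.ne' h3
  rw [h4]
  simp only [c]
  field_simp

lemma rpow_le_rpow_add_rpow (x : ℝ≥0∞) {a b c : ℝ} (hab : a ≤ b) (hbc : b ≤ c) :
    x ^ b ≤ x ^ a + x ^ c := by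
  rcases le_total x 1 with hx | hx
  · exact (ENNReal.rpow_le_rpow_of_exponent_ge hx hab).trans le_self_add
  · exact (ENNReal.rpow_le_rpow_of_exponent_le hx hbc).trans le_add_self

lemma tendsto_lintegral_rpow {X : Ω → ℝ≥0∞} (hX : Measurable X) (h0 : ∀ᵐ ω ∂P, X ω ≠ 0)
    (htop : ∀ᵐ ω ∂P, X ω ≠ ⊤) {a b c : ℝ} (ha : ∫⁻ ω, X ω ^ a ∂P ≠ ⊤)
    (hc : ∫⁻ ω, X ω ^ c ∂P ≠ ⊤) {u : ℕ → ℝ} (hu : Filter.Tendsto u Filter.atTop (nhds b))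
    (hau : ∀ n, a ≤ u n) (huc : ∀ n, u n ≤ c) :
    Filter.Tendsto (fun n => ∫⁻ ω, X ω ^ u n ∂P) Filter.atTop (nhds (∫⁻ ω, X ω ^ b ∂P)) := by
  refine tendsto_lintegral_of_dominated_convergence (fun ω => X ω ^ a + X ω ^ c)
    (fun n => hX.pow_const _)
    (fun n => .of_forall fun ω => rpow_le_rpow_add_rpow _ (hau n) (huc n)) ?_ ?_
  · rw [lintegral_add_left (hX.pow_const _)]
    exact ENNReal.add_ne_top.2 ⟨ha, hc⟩
  · filter_upwards [h0, htop] with ω hω0 hωtop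
    have hpos := ENNReal.toReal_pos hω0 hωtop
    have h (y : ℝ) : X ω ^ y = ENNReal.ofReal ((X ω).toReal ^ y) := by
      rw [← ENNReal.ofReal_rpow_of_pos hpos, ENNReal.ofReal_toReal hωtop]
    simp_rw [h]
    exact ENNReal.tendsto_ofReal (((Real.continuous_const_rpow hpos.ne').tendsto b).comp hu)

lemma lintegral_perpetuity_rpow_neg_one (hW : IsPreBrownianReal W P)
    (hm : ∀ t, Measurable (W t)) (hc : ∀ ω, Continuous (W · ω)) {p : ℝ} (hp : 0 < p) :
    ∫⁻ ω, perpetuity p (W · ω) ^ (-1 : ℝ) ∂P = ENNReal.ofReal (2 * p) := by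
  have := hW.isGaussianProcess.isProbabilityMeasure
  have hfin {q : ℝ} (hq : 0 ≤ q) := (lintegral_perpetuity_rpow_neg_lt_top hW hm hc p hq).ne
  have h0 : ∀ᵐ ω ∂P, perpetuity p (W · ω) ≠ 0 := .of_forall fun ω => (perpetuity_pos p (hc ω)).ne'
  have htop : ∀ᵐ ω ∂P, perpetuity p (W · ω) ≠ ⊤ :=
    (ae_perpetuity_lt_top hW hm hc hp).mono fun ω h => h.ne
  let u (n : ℕ) : ℝ := 1 / ((n : ℝ) + 1)
  have hu : Filter.Tendsto u Filter.atTop (nhds 0) := tendsto_one_div_add_atTop_nhds_zero_nat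
  have hu0 (n : ℕ) : 0 < u n := Nat.one_div_pos_of_nat
  have hu1 (n : ℕ) : u n ≤ 1 := by
    simp only [u]
    rw [div_le_one (by positivity)]
    linarith [Nat.cast_nonneg (α := ℝ) n]
  have hX := measurable_perpetuity hm hc p
  have hleft := tendsto_lintegral_rpow hX h0 htop (hfin zero_le_two) (hfin zero_le_one)
    (b := -1) (u := fun n => -(u n + 1)) (by simpa using (hu.add_const 1).neg)
    (fun n => by linarith [hu1 n]) (fun n => by linarith [hu0 n])
  have hright := tendsto_lintegral_rpow hX h0 htop (hfin zero_le_one) (hfin le_rfl)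
    (b := 0) (u := fun n => -u n) (by simpa using hu.neg)
    (fun n => by linarith [hu1 n]) (fun n => by linarith [hu0 n])
  simp only [ENNReal.rpow_zero, lintegral_const, measure_univ, mul_one] at hright
  have hcoef : Filter.Tendsto (fun n => ENNReal.ofReal (2 * (p + u n))) Filter.atTop
      (nhds (ENNReal.ofReal (2 * p))) :=
    ENNReal.tendsto_ofReal (by simpa using (hu.const_add p).const_mul 2)
  have hprod := ENNReal.Tendsto.mul hcoef (.inr ENNReal.one_ne_top) hright
    (.inr ENNReal.ofReal_ne_top)
  rw [mul_one] at hprod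
  exact tendsto_nhds_unique
    (hleft.congr fun n => lintegral_perpetuity_rpow_neg_add_one hW hm hc hp (hu0 n)) hprod

lemma lintegral_inv_perpetuity_pow (hW : IsPreBrownianReal W P)
    (hm : ∀ t, Measurable (W t)) (hc : ∀ ω, Continuous (W · ω)) {p : ℝ} (hp : 0 < p) (n : ℕ) :
    ∫⁻ ω, perpetuity p (W · ω) ^ (-(n : ℝ)) ∂P =
      ∫⁻ x, ENNReal.ofReal (x ^ n) ∂gammaMeasure p (1 / 2) := by
  have := hW.isGaussianProcess.isProbabilityMeasure
  have := isProbabilityMeasure_gammaMeasure hp (one_half_pos (α := ℝ))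
  induction n with
  | zero =>
    simp only [Nat.cast_zero, neg_zero, ENNReal.rpow_zero, pow_zero, ENNReal.ofReal_one,
      lintegral_const, measure_univ]
  | succ n ih =>
    rw [lintegral_pow_succ_gammaMeasure hp one_half_pos, ← ih,
      show (p + n) / (1 / 2) = 2 * (p + n) by ring]
    rcases n.eq_zero_or_pos with rfl | hn
    · simpa using lintegral_perpetuity_rpow_neg_one hW hm hc hp
    · push_cast
      exact lintegral_perpetuity_rpow_neg_add_one hW hm hc hp (Nat.cast_pos.2 hn)

/-- **Dufresne's identity** for a pre-Brownian motion with continuous paths. -/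
lemma map_inv_perpetuity_eq_gammaMeasure (hW : IsPreBrownianReal W P)
    (hm : ∀ t, Measurable (W t)) (hc : ∀ ω, Continuous (W · ω)) {p : ℝ} (hp : 0 < p) :
    P.map (fun ω => (perpetuity p (W · ω)).toReal⁻¹) = gammaMeasure p (1 / 2) := by
  have := hW.isGaussianProcess.isProbabilityMeasure
  have := isProbabilityMeasure_gammaMeasure hp (one_half_pos (α := ℝ))
  have hY : Measurable fun ω => (perpetuity p (W · ω)).toReal⁻¹ :=
    (measurable_perpetuity hm hc p).ennreal_toReal.inv
  have := Measure.isProbabilityMeasure_map (μ := P) hY.aemeasurable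
  refine Measure.ext_of_lintegral_pow_eq ?_ (ae_nonneg_gammaMeasure _ _)
    (a := 1 / 4) (by norm_num)
    (lintegral_exp_mul_gammaMeasure_lt_top hp one_half_pos (by norm_num)) fun n => ?_
  · exact (ae_map_iff hY.aemeasurable measurableSet_Ici).2
      (.of_forall fun ω => inv_nonneg.2 ENNReal.toReal_nonneg)
  · rw [← lintegral_inv_perpetuity_pow hW hm hc hp, lintegral_map (by fun_prop) hY]
    refine lintegral_congr_ae ?_
    filter_upwards [ae_perpetuity_lt_top hW hm hc hp] with ω hω
    rw [← ENNReal.toReal_inv, ENNReal.ofReal_pow ENNReal.toReal_nonneg,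
      ENNReal.ofReal_toReal (ENNReal.inv_ne_top.2 (perpetuity_pos p (hc ω)).ne'),
      ENNReal.rpow_neg, ENNReal.rpow_natCast, ENNReal.inv_pow]

lemma isPreBrownianReal_of_map_sum_eq_gaussianReal [IsProbabilityMeasure P]
    (hm : ∀ t, Measurable (W t))
    (h : ∀ (m : ℕ) (t : Fin m → ℝ≥0) (c : Fin m → ℝ),
      P.map (fun ω => ∑ i, c i * W (t i) ω) =
        gaussianReal 0 (Real.toNNReal (∑ i, ∑ j, c i * c j * min (t i : ℝ) (t j)))) :
    IsPreBrownianReal W P := by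
  have hlaw1 (t : ℝ≥0) : P.map (W t) = gaussianReal 0 t := by
    have := h 1 (fun _ => t) (fun _ => 1)
    simpa using this
  have hlaw2 (s t : ℝ≥0) (hst : s ≤ t) :
      P.map (W s + W t) = gaussianReal 0 (3 * s + t) := by
    have := h 2 ![s, t] ![1, 1]
    simp only [Fin.sum_univ_two, Matrix.cons_val_zero, Matrix.cons_val_one, one_mul, min_self,
      min_eq_left (NNReal.coe_le_coe.2 hst), min_eq_right (NNReal.coe_le_coe.2 hst)] at this
    have hv : Real.toNNReal ((s : ℝ) + s + (s + t)) = 3 * s + t := by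
      rw [← Real.toNNReal_coe (r := 3 * s + t)]
      congr 1
      push_cast
      ring
    rw [hv] at this
    exact this
  have hmem (t : ℝ≥0) : MemLp (W t) 2 P := by
    refine (memLp_map_measure_iff (g := id) (by fun_prop) (hm t).aemeasurable).1 ?_
    rw [hlaw1]
    exact memLp_id_gaussianReal 2
  have hvar {X : Ω → ℝ} (hX : Measurable X) {v : ℝ≥0} (hXv : P.map X = gaussianReal 0 v) :
      Var[X; P] = v := by
    rw [← variance_id_map hX.aemeasurable, hXv, variance_id_gaussianReal]
  refine IsGaussianProcess.isPreBrownianReal_of_covariance ⟨fun I => ⟨?_⟩⟩ (fun t => ?_)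
    fun s t hst => ?_
  · refine isGaussian_of_isGaussian_map fun L => ?_
    have hrestrict : Measurable fun ω => I.restrict (W · ω) :=
      measurable_pi_lambda _ fun i => hm i
    rw [Measure.map_map (by fun_prop) hrestrict]
    let e := I.equivFin
    have := h I.card (fun i => (e.symm i : ℝ≥0)) fun i => L (Pi.single (e.symm i) 1)
    have heq : L ∘ (fun ω => I.restrict (W · ω)) =
        fun ω => ∑ i, L (Pi.single (e.symm i) 1) * W (e.symm i) ω := by
      ext ω
      rw [Function.comp_apply, ← L.coe_coe, LinearMap.pi_apply_eq_sum_univ, ← e.symm.sum_comp]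
      refine Finset.sum_congr rfl fun i _ => ?_
      rw [smul_eq_mul, mul_comm]
      congr 2
      ext j
      simp [Pi.single_apply, eq_comm]
    rw [heq, this]
    infer_instance
  · have : ∫ ω, W t ω ∂P = ∫ x, x ∂(P.map (W t)) :=
      (integral_map (f := fun x => x) (hm t).aemeasurable (by fun_prop)).symm
    rw [this, hlaw1, integral_id_gaussianReal]
  · have hadd := variance_add (hmem s) (hmem t)
    rw [hvar (hm s) (hlaw1 s), hvar (hm t) (hlaw1 t),
      hvar ((hm s).add (hm t)) (hlaw2 s t hst)] at hadd
    push_cast at hadd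
    linarith

lemma integrableOn_perpetuityIntegrand {p : ℝ} {x : ℝ≥0 → ℝ} (hx : Continuous x)
    (h : perpetuity p x < ⊤) : IntegrableOn (perpetuityIntegrand p x) (Set.Ioi 0) := by
  refine ⟨(continuous_perpetuityIntegrand p hx).aestronglyMeasurable, ?_⟩
  rwa [hasFiniteIntegral_iff_ofReal (.of_forall fun s => (perpetuityIntegrand_pos p x s).le)]

lemma integral_perpetuityIntegrand {p : ℝ} {x : ℝ≥0 → ℝ} (hx : Continuous x) :
    ∫ s in Set.Ioi (0 : ℝ), perpetuityIntegrand p x s = (perpetuity p x).toReal :=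
  integral_eq_lintegral_of_nonneg_ae (.of_forall fun s => (perpetuityIntegrand_pos p x s).le)
    (continuous_perpetuityIntegrand p hx).aestronglyMeasurable

end Brownian

end Perpetuity

/-- Continuous-time Dufresne identity in dimension one. Let `B` be a standard Brownian
motion: an almost surely continuous centered Gaussian process with covariance
`Cov(B_s, B_t) = min s t` (encoded by requiring every finite linear combination
`Σ cᵢ B_{tᵢ}` with `tᵢ ≥ 0` to be centered Gaussian with variance
`Σᵢⱼ cᵢ cⱼ min(tᵢ, tⱼ)`). For `p > 0`, the perpetuity
`ι_∞ = ∫_0^∞ exp(-2 B_s - 2 p s) ds` is almost surely finite and strictly positive, and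
the law of `ι_∞⁻¹` is `Gamma(p, 1/2)`. -/
theorem stmt_19 (p : ℝ) (hp : 0 < p)
    {Ω : Type*} [MeasurableSpace Ω] (Pr : Measure Ω) [IsProbabilityMeasure Pr]
    (B : ℝ → Ω → ℝ) (hB_meas : ∀ t, Measurable (B t))
    (hB_cont : ∀ᵐ ω ∂Pr, ContinuousOn (fun t => B t ω) (Set.Ici 0))
    (hB_gauss : ∀ (m : ℕ) (t c : Fin m → ℝ), (∀ i, 0 ≤ t i) →
      Measure.map (fun ω => ∑ i, c i * B (t i) ω) Pr =
        gaussianReal 0 (Real.toNNReal (∑ i, ∑ j, c i * c j * min (t i) (t j)))) :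
    (∀ᵐ ω ∂Pr,
        IntegrableOn (fun s => Real.exp (-2 * B s ω - 2 * p * s)) (Set.Ioi 0) ∧
        0 < ∫ s in Set.Ioi (0 : ℝ), Real.exp (-2 * B s ω - 2 * p * s)) ∧
      Measure.map (fun ω => (∫ s in Set.Ioi (0 : ℝ), Real.exp (-2 * B s ω - 2 * p * s))⁻¹) Pr =
        gammaMeasure p (1 / 2) := by
  obtain ⟨S, hS, hSm, hScont⟩ : ∃ S : Set Ω, S ∈ ae Pr ∧ MeasurableSet S ∧
      ∀ ω ∈ S, ContinuousOn (fun t => B t ω) (Set.Ici 0) := hB_cont.exists_measurable_mem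
  let W (t : NNReal) : Ω → ℝ := S.indicator (B t)
  have hWm (t : NNReal) : Measurable (W t) := (hB_meas t).indicator hSm
  have hWB {ω : Ω} (hω : ω ∈ S) (t : NNReal) : W t ω = B t ω := Set.indicator_of_mem hω _
  have hWc (ω : Ω) : Continuous (W · ω) := by
    by_cases hω : ω ∈ S
    · simp_rw [hWB hω]
      exact (hScont ω hω).comp_continuous NNReal.continuous_coe fun t => t.2
    · simp only [W, Set.indicator_of_notMem hω]
      exact continuous_const
  have hW : IsPreBrownianReal W Pr := by
    refine isPreBrownianReal_of_map_sum_eq_gaussianReal hWm fun m t c => ?_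
    rw [← hB_gauss m (fun i => t i) c fun i => (t i).2]
    refine Measure.map_congr ?_
    filter_upwards [hS] with ω hω
    simp_rw [hWB hω]
  have heq {ω : Ω} (hω : ω ∈ S) : ∀ s ∈ Set.Ioi (0 : ℝ),
      perpetuityIntegrand p (W · ω) s = Real.exp (-2 * B s ω - 2 * p * s) := fun s hs => by
    rw [perpetuityIntegrand, hWB hω, Real.coe_toNNReal s (le_of_lt hs)]
  have hint {ω : Ω} (hω : ω ∈ S) :
      ∫ s in Set.Ioi (0 : ℝ), Real.exp (-2 * B s ω - 2 * p * s) =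
        (perpetuity p (W · ω)).toReal := by
    rw [← integral_perpetuityIntegrand (hWc ω), setIntegral_congr_fun measurableSet_Ioi (heq hω)]
  constructor
  · filter_upwards [hS, ae_perpetuity_lt_top hW hWm hWc hp] with ω hω hfin
    rw [hint hω]
    exact ⟨(integrableOn_perpetuityIntegrand (hWc ω) hfin).congr_fun (heq hω) measurableSet_Ioi,
      ENNReal.toReal_pos (perpetuity_pos p (hWc ω)).ne' hfin.ne⟩
  · rw [← map_inv_perpetuity_eq_gammaMeasure hW hWm hWc hp]
    refine Measure.map_congr ?_
    filter_upwards [hS] with ω hω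
    rw [hint hω]
end
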